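/- arXiv:2005.12628 — 8 statements merged into one kernel-verified Lean document; each statement's English description precedes it below -/
import Mathlib

section
/- Let ν̄ : (0,∞) → [0,∞) be nonincreasing with ∫₀¹ ν̄(s) ds < ∞ and lim_{t→0⁺} t·ν̄(t) = 0. Let T > 0 and let u : [0,T] → ℝ attain a maximum at a point t₀ ∈ (0,T]. Assume u is absolutely continuous on [0,t₀] (with derivative u' ∈ L¹(0,t₀)), u is continuously differentiable on (0,t₀], and the function τ ↦ ν̄(t₀−τ)u'(τ) is integrable on (0,t₀). Then ∫₀^{t₀} ν̄(t₀−τ) u'(τ) dτ ≥ 0. -/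
open MeasureTheory Set Filter
open scoped Topology

/-- If all tail integrals of `f` over `(a, b)` are nonnegative, then so is its integral over any
upward closed subset of `(0, b)`. -/
theorem setIntegral_nonneg_of_upwardClosed {f : ℝ → ℝ} {b : ℝ}
    (htail : ∀ a ∈ Ico 0 b, 0 ≤ ∫ x in Ioo a b, f x) {S : Set ℝ} (hS : S ⊆ Ioo 0 b)
    (hup : ∀ x ∈ S, ∀ y ∈ Ioo 0 b, x ≤ y → y ∈ S) : 0 ≤ ∫ x in S, f x := by
  rcases S.eq_empty_or_nonempty with rfl | ⟨c, hc⟩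
  · simp
  have hbdd : BddBelow S := ⟨0, fun x hx => (hS hx).1.le⟩
  have ha0 : 0 ≤ sInf S := le_csInf ⟨c, hc⟩ fun x hx => (hS hx).1.le
  have hab : sInf S < b := (csInf_le hbdd hc).trans_lt (hS hc).2
  have hsub : Ioo (sInf S) b ⊆ S := fun y hy => by
    obtain ⟨x, hx, hxy⟩ := exists_lt_of_csInf_lt ⟨c, hc⟩ hy.1
    exact hup x hx y ⟨ha0.trans_lt hy.1, hy.2⟩ hxy.le
  have hsup : S ⊆ Ico (sInf S) b := fun x hx => ⟨csInf_le hbdd hx, (hS hx).2⟩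
  have hae : S =ᵐ[volume] Ioo (sInf S) b :=
    (hsup.eventuallyLE.trans Ioo_ae_eq_Ico.symm.le).antisymm hsub.eventuallyLE
  rw [setIntegral_congr_set hae]
  exact htail _ ⟨ha0, hab⟩

/-- If all tail integrals of `f` over `(a, b)` are nonnegative, then the integral of `f` against a
nonnegative nondecreasing weight is nonnegative. -/
theorem setIntegral_mul_nonneg_of_monotoneOn {w f : ℝ → ℝ} {b : ℝ}
    (hw0 : ∀ x ∈ Ioo 0 b, 0 ≤ w x) (hw : MonotoneOn w (Ioo 0 b))
    (hf : IntegrableOn f (Ioo 0 b)) (hwf : IntegrableOn (fun x => w x * f x) (Ioo 0 b))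
    (htail : ∀ a ∈ Ico 0 b, 0 ≤ ∫ x in Ioo a b, f x) :
    0 ≤ ∫ x in Ioo 0 b, w x * f x := by
  let F : ℝ → ℝ → ℝ := fun x s => (Iio (w x)).indicator (fun _ => f x) s
  have hwm : AEMeasurable w (volume.restrict (Ioo 0 b)) :=
    aemeasurable_restrict_of_monotoneOn measurableSet_Ioo hw
  have hmass : ∀ x ∈ Ioo 0 b, (volume.restrict (Ioi (0 : ℝ))).real (Iio (w x)) = w x := by
    intro x hx
    rw [measureReal_restrict_apply measurableSet_Iio, inter_comm, Ioi_inter_Iio,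
      Real.volume_real_Ioo_of_le (hw0 x hx), sub_zero]
  have hfin : ∀ x, (volume.restrict (Ioi (0 : ℝ))) (Iio (w x)) ≠ ⊤ := fun x => by
    rw [Measure.restrict_apply measurableSet_Iio, inter_comm, Ioi_inter_Iio]
    exact measure_Ioo_lt_top.ne
  have hFmeas : AEStronglyMeasurable (Function.uncurry F)
      ((volume.restrict (Ioo 0 b)).prod (volume.restrict (Ioi 0))) :=
    hf.aestronglyMeasurable.comp_fst.indicator₀
      (nullMeasurableSet_lt measurable_snd.aemeasurable hwm.comp_fst)
  have hFint : Integrable (Function.uncurry F)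
      ((volume.restrict (Ioo 0 b)).prod (volume.restrict (Ioi 0))) := by
    refine (integrable_prod_iff hFmeas).2 ⟨.of_forall fun x => ?_, ?_⟩
    · exact (integrable_indicator_iff measurableSet_Iio).2 (integrableOn_const (C := f x) (hfin x))
    · refine hwf.norm.congr ?_
      filter_upwards [ae_restrict_mem measurableSet_Ioo] with x hx
      simp only [Function.uncurry, F, norm_indicator_eq_indicator_norm]
      rw [integral_indicator_const _ measurableSet_Iio, hmass x hx, smul_eq_mul, norm_mul,
        Real.norm_of_nonneg (hw0 x hx)]
  have hswap : ∫ x in Ioo 0 b, w x * f x = ∫ s in Ioi 0, ∫ x in Ioo 0 b, F x s := by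
    rw [← integral_integral_swap hFint]
    refine setIntegral_congr_fun measurableSet_Ioo fun x hx => ?_
    simp only [F]
    rw [integral_indicator_const _ measurableSet_Iio, hmass x hx, smul_eq_mul]
  rw [hswap]
  refine integral_nonneg fun s => ?_
  have hnull : NullMeasurableSet {x | s < w x} (volume.restrict (Ioo 0 b)) :=
    nullMeasurableSet_lt aemeasurable_const hwm
  change 0 ≤ ∫ x in Ioo 0 b, {x | s < w x}.indicator f x
  rw [integral_indicator₀ hnull, Measure.restrict_restrict₀ hnull]
  exact setIntegral_nonneg_of_upwardClosed htail inter_subset_right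
    fun x hx y hy hxy => ⟨lt_of_lt_of_le hx.1 (hw hx.2 hy hxy), hy⟩

/-- Extremal point property of the Caputo-type non-local derivative:
if `u` attains a maximum at `t₀`, then `∫₀^{t₀} ν̄(t₀−τ) u'(τ) dτ ≥ 0`. -/
theorem stmt_0 (nu : ℝ → ℝ)
    (hnu_nonneg : ∀ t ∈ Set.Ioi (0:ℝ), 0 ≤ nu t)
    (hnu_anti : AntitoneOn nu (Set.Ioi 0))
    (hnu_int : IntegrableOn nu (Set.Ioc 0 1))
    (hnu_lim : Tendsto (fun t => t * nu t) (𝓝[>] (0:ℝ)) (𝓝 0))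
    (T : ℝ) (hT : 0 < T) (u u' : ℝ → ℝ) (t₀ : ℝ) (ht₀ : t₀ ∈ Set.Ioc 0 T)
    (hmax : ∀ t ∈ Set.Icc 0 T, u t ≤ u t₀)
    (hu'_int : IntegrableOn u' (Set.Ioc 0 t₀))
    (hAC : ∀ t ∈ Set.Icc 0 t₀, u t = u 0 + ∫ s in Set.Ioc 0 t, u' s)
    (hderiv : ∀ t ∈ Set.Ioc 0 t₀, HasDerivAt u (u' t) t)
    (hu'_cont : ContinuousOn u' (Set.Ioc 0 t₀))
    (hint : IntegrableOn (fun τ => nu (t₀ - τ) * u' τ) (Set.Ioo 0 t₀)) :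
    0 ≤ ∫ τ in Set.Ioo 0 t₀, nu (t₀ - τ) * u' τ := by
  refine setIntegral_mul_nonneg_of_monotoneOn
    (fun τ hτ => hnu_nonneg _ (sub_pos.2 hτ.2))
    (fun τ hτ σ hσ h => hnu_anti (sub_pos.2 hσ.2) (sub_pos.2 hτ.2) (by linarith))
    (hu'_int.mono_set Ioo_subset_Ioc_self) hint fun a ha => ?_
  have hsplit : ∫ s in Ioc 0 t₀, u' s = (∫ s in Ioc 0 a, u' s) + ∫ s in Ioc a t₀, u' s := by
    rw [← Ioc_union_Ioc_eq_Ioc ha.1 ha.2.le]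
    exact setIntegral_union (Ioc_disjoint_Ioc_of_le le_rfl) measurableSet_Ioc
      (hu'_int.mono_set (Ioc_subset_Ioc_right ha.2.le))
      (hu'_int.mono_set (Ioc_subset_Ioc_left ha.1))
  rw [← integral_Ioc_eq_integral_Ioo]
  linarith [hAC a ⟨ha.1, ha.2.le⟩, hAC t₀ ⟨ht₀.1.le, le_rfl⟩, hmax a ⟨ha.1, ha.2.le.trans ht₀.2⟩]
end

section
/- lim_{t→0⁺} V_{2,H}(t)/t^{2H} = 1. -/
open MeasureTheory Set Filter
open scoped Topology

lemma intervalIntegrable_and_integral_abs_rpow {p : ℝ} (hp : 0 < p) {a b : ℝ} (ha : 0 ≤ a)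
    (hb : 0 ≤ b) :
    IntervalIntegrable (fun x : ℝ => |x| ^ (p - 1)) volume (-a) b ∧
      ∫ x in (-a)..b, |x| ^ (p - 1) = (a ^ p + b ^ p) / p := by
  have pos : ∀ c : ℝ, 0 ≤ c → IntervalIntegrable (fun x : ℝ => |x| ^ (p - 1)) volume 0 c ∧
      ∫ x in (0 : ℝ)..c, |x| ^ (p - 1) = c ^ p / p := by
    intro c hc
    have key : ∀ x ∈ uIcc 0 c, x ^ (p - 1) = |x| ^ (p - 1) := by
      intro x hx
      rw [uIcc_of_le hc] at hx
      rw [abs_of_nonneg hx.1]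
    refine ⟨?_, ?_⟩
    · exact (intervalIntegral.intervalIntegrable_rpow' (by linarith)).congr
        fun x hx => key x (uIoc_subset_uIcc hx)
    · rw [← intervalIntegral.integral_congr key, integral_rpow (Or.inl (by linarith))]
      simp [hp.ne']
  have neg : IntervalIntegrable (fun x : ℝ => |x| ^ (p - 1)) volume (-a) 0 := by
    have := (pos a ha).1.comp_sub_left 0
    simpa using this.symm
  refine ⟨neg.trans (pos b hb).1, ?_⟩
  rw [← intervalIntegral.integral_add_adjacent_intervals neg (pos b hb).1, (pos b hb).2]
  have := intervalIntegral.integral_comp_neg (a := 0) (b := a) (fun x : ℝ => |x| ^ (p - 1))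
  simp only [abs_neg, neg_zero] at this
  rw [← this, (pos a ha).2]
  ring

lemma intervalIntegrable_abs_sub_rpow {p : ℝ} (hp : 0 < p) {u t : ℝ} (hu : u ∈ Icc 0 t) :
    IntervalIntegrable (fun v : ℝ => |u - v| ^ (p - 1)) volume 0 t := by
  have := (intervalIntegrable_and_integral_abs_rpow hp hu.1 (sub_nonneg.2 hu.2)).1.comp_sub_right u
  simpa [abs_sub_comm] using this

lemma integral_abs_sub_rpow {p : ℝ} (hp : 0 < p) {u t : ℝ} (hu : u ∈ Icc 0 t) :
    ∫ v in (0 : ℝ)..t, |u - v| ^ (p - 1) = (u ^ p + (t - u) ^ p) / p := by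
  rw [← (intervalIntegrable_and_integral_abs_rpow hp hu.1 (sub_nonneg.2 hu.2)).2]
  have := intervalIntegral.integral_comp_sub_right (a := 0) (b := t)
    (fun x : ℝ => |x| ^ (p - 1)) u
  simpa [abs_sub_comm] using this

lemma intervalIntegrable_rpow_add_sub_rpow {p : ℝ} (hp : 0 < p) (t : ℝ) :
    IntervalIntegrable (fun u : ℝ => (u ^ p + (t - u) ^ p) / p) volume 0 t := by
  apply Continuous.intervalIntegrable
  have := hp.le
  exact ((Real.continuous_rpow_const this).add
    ((Real.continuous_rpow_const this).comp (by fun_prop))).div_const _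

lemma integral_rpow_add_sub_rpow {p : ℝ} (hp : 0 < p) (t : ℝ) :
    ∫ u in (0 : ℝ)..t, (u ^ p + (t - u) ^ p) / p = 2 * t ^ (p + 1) / (p * (p + 1)) := by
  have hc : Continuous fun u : ℝ => u ^ p := Real.continuous_rpow_const hp.le
  have h1 : ∫ u in (0 : ℝ)..t, u ^ p = t ^ (p + 1) / (p + 1) := by
    rw [integral_rpow (Or.inl (by linarith)), Real.zero_rpow (by linarith), sub_zero]
  have h2 : ∫ u in (0 : ℝ)..t, (t - u) ^ p = t ^ (p + 1) / (p + 1) := by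
    have := intervalIntegral.integral_comp_sub_left (a := 0) (b := t) (fun x : ℝ => x ^ p) t
    rw [this, sub_self, sub_zero, h1]
  have hc' : Continuous fun u : ℝ => (t - u) ^ p :=
    hc.comp (by fun_prop : Continuous fun u : ℝ => t - u)
  rw [intervalIntegral.integral_div, intervalIntegral.integral_add (hc.intervalIntegrable _ _)
    (hc'.intervalIntegrable _ _), h1, h2]
  field_simp
  ring

/-- Bounds for a weighted double integral of `|u - v| ^ (p - 1)` over a square. -/
lemma integral_integral_mul_abs_sub_rpow_mem_Icc {p t C : ℝ} (hp : 0 < p) (ht : 0 ≤ t)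
    {w : ℝ → ℝ → ℝ} (hw : Continuous fun z : ℝ × ℝ => w z.1 z.2)
    (hwC : ∀ u ∈ Icc 0 t, ∀ v ∈ Icc 0 t, w u v ∈ Icc 1 C) :
    (∫ u in (0 : ℝ)..t, ∫ v in (0 : ℝ)..t, w u v * |u - v| ^ (p - 1)) ∈
      Icc (2 * t ^ (p + 1) / (p * (p + 1))) (C * (2 * t ^ (p + 1) / (p * (p + 1)))) := by
  have hinner : ∀ u ∈ Icc 0 t, (∫ v in (0 : ℝ)..t, w u v * |u - v| ^ (p - 1)) ∈
      Icc ((u ^ p + (t - u) ^ p) / p) (C * ((u ^ p + (t - u) ^ p) / p)) := by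
    intro u hu
    have hi := intervalIntegrable_abs_sub_rpow hp hu
    have hwi : IntervalIntegrable (fun v => w u v * |u - v| ^ (p - 1)) volume 0 t :=
      hi.continuousOn_mul (hw.comp (by fun_prop : Continuous fun v : ℝ => (u, v))).continuousOn
    rw [← integral_abs_sub_rpow hp hu, ← intervalIntegral.integral_const_mul]
    refine ⟨intervalIntegral.integral_mono_on ht hi hwi fun v hv => ?_,
      intervalIntegral.integral_mono_on ht hwi (hi.const_mul C) fun v hv => ?_⟩
    · exact le_mul_of_one_le_left (by positivity) (hwC u hu v hv).1
    · exact mul_le_mul_of_nonneg_right (hwC u hu v hv).2 (by positivity)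
  have hF := intervalIntegrable_rpow_add_sub_rpow hp t
  have hmeas : StronglyMeasurable fun u => ∫ v in (0 : ℝ)..t, w u v * |u - v| ^ (p - 1) := by
    simp only [intervalIntegral.integral_of_le ht]
    refine StronglyMeasurable.integral_prod_right
      (f := fun u v => w u v * |u - v| ^ (p - 1)) ?_
    refine Measurable.stronglyMeasurable (hw.measurable.mul ?_)
    exact (by fun_prop : Measurable fun z : ℝ × ℝ => |z.1 - z.2|).pow_const _
  have hG : IntervalIntegrable (fun u => ∫ v in (0 : ℝ)..t, w u v * |u - v| ^ (p - 1))
      volume 0 t := by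
    refine (hF.const_mul C).mono_fun' hmeas.aestronglyMeasurable ?_
    filter_upwards [ae_restrict_mem measurableSet_uIoc] with u hu
    rw [uIoc_of_le ht] at hu
    have hu' := Ioc_subset_Icc_self hu
    have h0 : 0 ≤ (u ^ p + (t - u) ^ p) / p := by
      have h1 := Real.rpow_nonneg hu'.1 p
      have h2 := Real.rpow_nonneg (sub_nonneg.2 hu'.2) p
      positivity
    rw [Real.norm_of_nonneg (h0.trans (hinner u hu').1)]
    exact (hinner u hu').2
  rw [← integral_rpow_add_sub_rpow hp, ← intervalIntegral.integral_const_mul]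
  exact ⟨intervalIntegral.integral_mono_on ht hF hG fun u hu => (hinner u hu).1,
    intervalIntegral.integral_mono_on ht hG (hF.const_mul C) fun u hu => (hinner u hu).2⟩

/-- For the variance `V_{2,H}` of the fractional Ornstein–Uhlenbeck process,
`lim_{t→0⁺} V_{2,H}(t)/t^{2H} = 1`. -/
theorem stmt_1 (H θ : ℝ) (hH : H ∈ Set.Ioo (1/2 : ℝ) 1) (hθ : 0 < θ)
    (V : ℝ → ℝ)
    (hV : ∀ t : ℝ, V t = H * (2*H - 1) * Real.exp (-2*t/θ) *
      ∫ u in (0:ℝ)..t, ∫ v in (0:ℝ)..t, Real.exp ((u+v)/θ) * |u - v| ^ (2*H - 2)) :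
    Tendsto (fun t => V t / t ^ (2*H)) (𝓝[>] (0:ℝ)) (𝓝 1) := by
  have hp : 0 < 2 * H - 1 := by linarith [hH.1]
  have hH0 : 0 < H := by linarith [hH.1]
  have hlim : Tendsto (fun t : ℝ => Real.exp (-2 * t / θ)) (𝓝[>] 0) (𝓝 1) := by
    have hc : Continuous fun t : ℝ => Real.exp (-2 * t / θ) := by fun_prop
    simpa using (hc.tendsto 0).mono_left nhdsWithin_le_nhds
  have hbounds : ∀ t ∈ Ioi (0 : ℝ), V t / t ^ (2 * H) ∈ Icc (Real.exp (-2 * t / θ)) 1 := by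
    intro t ht
    have ht0 : 0 < t := ht
    have hpow : 0 < t ^ (2 * H) := Real.rpow_pos_of_pos ht0 _
    have hI := integral_integral_mul_abs_sub_rpow_mem_Icc (C := Real.exp (2 * t / θ))
      (w := fun u v => Real.exp ((u + v) / θ)) hp ht0.le (by fun_prop) fun u hu v hv =>
        ⟨Real.one_le_exp (div_nonneg (add_nonneg hu.1 hv.1) hθ.le),
          Real.exp_le_exp.2 (by gcongr; linarith [hu.2, hv.2])⟩
    rw [show 2 * H - 1 - 1 = 2 * H - 2 by ring, show 2 * H - 1 + 1 = 2 * H by ring,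
      show 2 * t ^ (2 * H) / ((2 * H - 1) * (2 * H)) = t ^ (2 * H) / (H * (2 * H - 1)) by
        field_simp] at hI
    have hexp : Real.exp (-2 * t / θ) * Real.exp (2 * t / θ) = 1 := by
      rw [← Real.exp_add, ← Real.exp_zero]
      congr 1
      ring
    have hK : 0 ≤ H * (2 * H - 1) * Real.exp (-2 * t / θ) := by positivity
    rw [hV t]
    constructor
    · rw [le_div_iff₀ hpow]
      refine le_of_eq_of_le ?_ (mul_le_mul_of_nonneg_left hI.1 hK)
      field_simp
    · rw [div_le_one hpow]
      refine (mul_le_mul_of_nonneg_left hI.2 hK).trans_eq ?_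
      calc _ = (Real.exp (-2 * t / θ) * Real.exp (2 * t / θ)) *
            (H * (2 * H - 1) * (t ^ (2 * H) / (H * (2 * H - 1)))) := by ring
        _ = t ^ (2 * H) := by
          rw [hexp, one_mul, mul_div_cancel₀ _ (mul_pos hH0 hp).ne']
  exact tendsto_of_tendsto_of_tendsto_of_le_of_le' hlim tendsto_const_nhds
    (eventually_mem_nhdsWithin.mono fun t ht => (hbounds t ht).1)
    (eventually_mem_nhdsWithin.mono fun t ht => (hbounds t ht).2)
end

section
/- lim_{t→+∞} V_{2,H}(t) = θ^{2H} H Γ(2H), where Γ denotes the Gamma function. -/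
open MeasureTheory Set Filter
open scoped Topology

/-- The primitive `x ↦ ∫₀ˣ e^{cs} s^a ds`. -/
noncomputable def expRpowPrimitive (a c x : ℝ) : ℝ :=
  ∫ s in (0:ℝ)..x, Real.exp (c * s) * s ^ a

theorem intervalIntegrable_exp_mul_rpow {a : ℝ} (ha : -1 < a) (c x y : ℝ) :
    IntervalIntegrable (fun s : ℝ => Real.exp (c * s) * s ^ a) volume x y :=
  (intervalIntegral.intervalIntegrable_rpow' ha).continuousOn_mul (by fun_prop)

theorem continuous_expRpowPrimitive {a : ℝ} (ha : -1 < a) (c : ℝ) :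
    Continuous (expRpowPrimitive a c) :=
  intervalIntegral.continuous_primitive (intervalIntegrable_exp_mul_rpow ha c) 0

theorem hasDerivAt_expRpowPrimitive {a : ℝ} (ha : -1 < a) (c : ℝ) {x : ℝ} (hx : 0 < x) :
    HasDerivAt (expRpowPrimitive a c) (Real.exp (c * x) * x ^ a) x := by
  refine intervalIntegral.integral_hasDerivAt_right (intervalIntegrable_exp_mul_rpow ha c 0 x) ?_ ?_
  · exact (Measurable.stronglyMeasurable (by fun_prop)).stronglyMeasurableAtFilter
  · exact ContinuousAt.mul (by fun_prop) (Real.continuousAt_rpow_const x a (Or.inl hx.ne'))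

theorem integral_exp_mul_expRpowPrimitive {a c : ℝ} (ha : -1 < a) (hc : c ≠ 0) {t : ℝ}
    (ht : 0 ≤ t) :
    ∫ x in (0:ℝ)..t, Real.exp (-(2 * c) * x) * expRpowPrimitive a c x =
      (expRpowPrimitive a (-c) t - Real.exp (-(2 * c) * t) * expRpowPrimitive a c t) / (2 * c) := by
  have h := intervalIntegral.integral_mul_deriv_eq_deriv_mul_of_hasDeriv_right
    (a := 0) (b := t) (u := expRpowPrimitive a c) (u' := fun x => Real.exp (c * x) * x ^ a)
    (v := fun x => -Real.exp (-(2 * c) * x) / (2 * c)) (v' := fun x => Real.exp (-(2 * c) * x))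
    (continuous_expRpowPrimitive ha c).continuousOn (by fun_prop)
    (fun x hx => (hasDerivAt_expRpowPrimitive ha c
      (by simpa [ht] using hx.1)).hasDerivWithinAt)
    (fun x _ => by
      have := ((((hasDerivAt_id x).const_mul (-(2 * c))).exp.neg).div_const (2 * c))
      refine (this.congr_deriv ?_).hasDerivWithinAt
      simp only [id]
      field_simp)
    (intervalIntegrable_exp_mul_rpow ha c 0 t)
    (Continuous.intervalIntegrable (by fun_prop) _ _)
  have h0 : expRpowPrimitive a c 0 = 0 := by simp [expRpowPrimitive]
  have h1 : ∫ x in (0:ℝ)..t, Real.exp (c * x) * x ^ a * (-Real.exp (-(2 * c) * x) / (2 * c)) =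
      -expRpowPrimitive a (-c) t / (2 * c) := by
    rw [expRpowPrimitive, ← intervalIntegral.integral_neg, ← intervalIntegral.integral_div]
    congr 1 with x
    have : Real.exp (-c * x) = Real.exp (c * x) * Real.exp (-(2 * c) * x) := by
      rw [← Real.exp_add]; ring_nf
    rw [this]; ring
  rw [h1, h0] at h
  simp_rw [mul_comm (Real.exp _) (expRpowPrimitive _ _ _)]
  rw [h]
  ring

theorem integral_exp_mul_abs_sub_rpow {a : ℝ} (ha : -1 < a) (c : ℝ) {t u : ℝ}
    (hu : 0 ≤ u) (hut : u ≤ t) :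
    ∫ v in (0:ℝ)..t, Real.exp (c * (u + v)) * |u - v| ^ a =
      Real.exp (2 * c * u) * expRpowPrimitive a (-c) u +
        Real.exp (2 * c * u) * expRpowPrimitive a c (t - u) := by
  have e1 : EqOn (fun v => Real.exp (2 * c * u) * (Real.exp (-c * (u - v)) * (u - v) ^ a))
      (fun v => Real.exp (c * (u + v)) * |u - v| ^ a) (uIcc 0 u) := fun v hv => by
    rw [uIcc_of_le hu] at hv
    simp only [abs_of_nonneg (sub_nonneg.2 hv.2)]
    rw [← mul_assoc, ← Real.exp_add]; ring_nf
  have e2 : EqOn (fun v => Real.exp (2 * c * u) * (Real.exp (c * (v - u)) * (v - u) ^ a))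
      (fun v => Real.exp (c * (u + v)) * |u - v| ^ a) (uIcc u t) := fun v hv => by
    rw [uIcc_of_le hut] at hv
    simp only [abs_sub_comm u v, abs_of_nonneg (sub_nonneg.2 hv.1)]
    rw [← mul_assoc, ← Real.exp_add]; ring_nf
  have i1 : IntervalIntegrable (fun v => Real.exp (c * (u + v)) * |u - v| ^ a) volume 0 u := by
    refine IntervalIntegrable.congr (fun v hv => e1 (uIoc_subset_uIcc hv)) ?_
    have := (intervalIntegrable_exp_mul_rpow ha (-c) u 0).comp_sub_left u
    simp only [sub_self, sub_zero] at this
    exact this.const_mul _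
  have i2 : IntervalIntegrable (fun v => Real.exp (c * (u + v)) * |u - v| ^ a) volume u t := by
    refine IntervalIntegrable.congr (fun v hv => e2 (uIoc_subset_uIcc hv)) ?_
    have := (intervalIntegrable_exp_mul_rpow ha c 0 (t - u)).comp_sub_right u
    simp only [zero_add, sub_add_cancel] at this
    exact this.const_mul _
  rw [← intervalIntegral.integral_add_adjacent_intervals i1 i2,
    ← intervalIntegral.integral_congr e1, ← intervalIntegral.integral_congr e2,
    intervalIntegral.integral_const_mul, intervalIntegral.integral_const_mul,
    intervalIntegral.integral_comp_sub_left (fun s => Real.exp (-c * s) * s ^ a),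
    intervalIntegral.integral_comp_sub_right (fun s => Real.exp (c * s) * s ^ a)]
  simp [expRpowPrimitive]

theorem integral_integral_exp_mul_abs_sub_rpow {a c : ℝ} (ha : -1 < a) (hc : c ≠ 0) {t : ℝ}
    (ht : 0 ≤ t) :
    ∫ u in (0:ℝ)..t, ∫ v in (0:ℝ)..t, Real.exp (c * (u + v)) * |u - v| ^ a =
      (Real.exp (2 * c * t) * expRpowPrimitive a (-c) t - expRpowPrimitive a c t) / c := by
  have hK := continuous_expRpowPrimitive ha c
  have hG := continuous_expRpowPrimitive ha (-c)
  have h1 := integral_exp_mul_expRpowPrimitive ha (neg_ne_zero.2 hc) ht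
  have h2 : ∫ u in (0:ℝ)..t, Real.exp (2 * c * u) * expRpowPrimitive a c (t - u) =
      Real.exp (2 * c * t) *
        ∫ x in (0:ℝ)..t, Real.exp (-(2 * c) * x) * expRpowPrimitive a c x := by
    have := intervalIntegral.integral_comp_sub_left (a := 0) (b := t)
      (fun x => Real.exp (2 * c * t) * (Real.exp (-(2 * c) * x) * expRpowPrimitive a c x)) t
    rw [sub_self, sub_zero] at this
    rw [← intervalIntegral.integral_const_mul, ← this]
    congr 1 with u
    rw [← mul_assoc, ← Real.exp_add]; ring_nf
  have h3 : Real.exp (2 * c * t) * Real.exp (-(2 * c) * t) = 1 := by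
    rw [← Real.exp_add]; simp
  rw [intervalIntegral.integral_congr (g := fun u =>
    Real.exp (2 * c * u) * expRpowPrimitive a (-c) u +
        Real.exp (2 * c * u) * expRpowPrimitive a c (t - u)) (fun u hu => by
      rw [uIcc_of_le ht] at hu
      exact integral_exp_mul_abs_sub_rpow ha c hu.1 hu.2),
    intervalIntegral.integral_add (Continuous.intervalIntegrable (by fun_prop) _ _)
      (Continuous.intervalIntegrable (by fun_prop) _ _), h2,
    integral_exp_mul_expRpowPrimitive ha hc ht]
  simp only [mul_neg, neg_neg] at h1
  rw [h1]
  rw [neg_mul] at h3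
  field_simp
  linear_combination (-expRpowPrimitive a c t) * h3

theorem tendsto_expRpowPrimitive_neg {a c : ℝ} (ha : -1 < a) (hc : 0 < c) :
    Tendsto (expRpowPrimitive a (-c)) atTop (𝓝 (c⁻¹ ^ (a + 1) * Real.Gamma (a + 1))) := by
  have h := Real.integral_rpow_mul_exp_neg_mul_Ioi (a := a + 1) (r := c) (by linarith) hc
  have hi : IntegrableOn (fun s : ℝ => Real.exp (-c * s) * s ^ a) (Ioi 0) := by
    have := integrableOn_rpow_mul_exp_neg_mul_rpow (p := 1) (s := a) (b := c) ha (by norm_num) hc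
    simpa [mul_comm] using this
  have hval : ∫ s in Ioi (0:ℝ), Real.exp (-c * s) * s ^ a =
      c⁻¹ ^ (a + 1) * Real.Gamma (a + 1) := by
    rw [← one_div, ← h]
    congr 1 with s
    rw [mul_comm, add_sub_cancel_right, neg_mul]
  rw [← hval]
  exact intervalIntegral_tendsto_integral_Ioi 0 hi tendsto_id

theorem tendsto_exp_mul_expRpowPrimitive {a c : ℝ} (ha : -1 < a) (hc : 0 < c) :
    Tendsto (fun t => Real.exp (-(2 * c) * t) * expRpowPrimitive a c t) atTop (𝓝 0) := by
  have h := (tendsto_rpow_mul_exp_neg_mul_atTop_nhds_zero (a + 1) c hc).div_const (a + 1)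
  rw [zero_div] at h
  refine squeeze_zero' ?_ ?_ h
  · filter_upwards [eventually_ge_atTop 0] with t ht
    refine mul_nonneg (Real.exp_pos _).le (intervalIntegral.integral_nonneg ht fun s hs => ?_)
    exact mul_nonneg (Real.exp_pos _).le (Real.rpow_nonneg hs.1 _)
  · filter_upwards [eventually_ge_atTop 0] with t ht
    have hK : expRpowPrimitive a c t ≤ Real.exp (c * t) * (t ^ (a + 1) / (a + 1)) := by
      have h0 : (0:ℝ) ^ (a + 1) = 0 := Real.zero_rpow (by linarith)
      have hint := integral_rpow (a := 0) (b := t) (r := a) (Or.inl ha)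
      rw [h0, sub_zero] at hint
      rw [← hint, ← intervalIntegral.integral_const_mul]
      refine intervalIntegral.integral_mono_on ht (intervalIntegrable_exp_mul_rpow ha c 0 t)
        ((intervalIntegral.intervalIntegrable_rpow' ha).const_mul _) fun s hs => ?_
      have := Real.rpow_nonneg hs.1 a
      have := hs.2
      gcongr
    calc _ ≤ Real.exp (-(2 * c) * t) * (Real.exp (c * t) * (t ^ (a + 1) / (a + 1))) := by gcongr
      _ = _ := by
        rw [← mul_assoc, ← Real.exp_add]; ring_nf

/-- For the variance `V_{2,H}` of the fractional Ornstein–Uhlenbeck process,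
`lim_{t→+∞} V_{2,H}(t) = θ^{2H} H Γ(2H)`. -/
theorem stmt_2 (H θ : ℝ) (hH : H ∈ Set.Ioo (1/2 : ℝ) 1) (hθ : 0 < θ)
    (V : ℝ → ℝ)
    (hV : ∀ t : ℝ, V t = H * (2*H - 1) * Real.exp (-2*t/θ) *
      ∫ u in (0:ℝ)..t, ∫ v in (0:ℝ)..t, Real.exp ((u+v)/θ) * |u - v| ^ (2*H - 2)) :
    Tendsto V atTop (𝓝 (θ ^ (2*H) * H * Real.Gamma (2*H))) := by
  have ha : -1 < 2 * H - 2 := by linarith [hH.1]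
  have hc : 0 < θ⁻¹ := inv_pos.2 hθ
  have hlim := ((tendsto_expRpowPrimitive_neg ha hc).sub
    (tendsto_exp_mul_expRpowPrimitive ha hc)).const_mul (H * (2 * H - 1) * θ)
  have hGamma : Real.Gamma (2 * H) = (2 * H - 1) * Real.Gamma (2 * H - 1) := by
    rw [← Real.Gamma_add_one (by linarith [hH.1]), sub_add_cancel]
  have hpow : θ ^ (2 * H) = θ ^ (2 * H - 1) * θ := by
    rw [← Real.rpow_add_one hθ.ne', sub_add_cancel]
  have hexp : 2 * H - 2 + 1 = 2 * H - 1 := by ring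
  have hval : H * (2 * H - 1) * θ *
      (θ⁻¹⁻¹ ^ (2 * H - 2 + 1) * Real.Gamma (2 * H - 2 + 1) - 0) =
      θ ^ (2 * H) * H * Real.Gamma (2 * H) := by
    rw [hGamma, hpow, inv_inv, hexp]; ring
  rw [hval] at hlim
  refine hlim.congr' ?_
  filter_upwards [eventually_ge_atTop 0] with t ht
  have hdiv : -2 * t / θ = -(2 * θ⁻¹) * t := by ring
  have h3 : Real.exp (-(2 * θ⁻¹) * t) * Real.exp (2 * θ⁻¹ * t) = 1 := by
    rw [← Real.exp_add]; simp
  simp_rw [hV, div_eq_inv_mul _ θ] at *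
  rw [integral_integral_exp_mul_abs_sub_rpow ha hc.ne' ht, div_inv_eq_mul, hdiv]
  linear_combination (-(H * (2 * H - 1) * θ * expRpowPrimitive (2 * H - 2) (-θ⁻¹) t)) * h3
end

section
/- Let Φ : (0,∞) → (0,∞) be continuous, strictly increasing, with lim_{λ→0⁺} Φ(λ) = 0 and lim_{λ→+∞} Φ(λ) = +∞, and let f : (0,∞) × (0,∞) → [0,∞) be measurable with ∫₀^∞ f(s,t) ds = 1 for every t > 0 and ∫₀^∞ e^{−λt} f(s,t) dt = (Φ(λ)/λ) e^{−sΦ(λ)} for every s > 0 and λ > 0. Let v : (0,∞) → ℝ be bounded and continuous. If S_Φ v(t) = ∫₀^∞ v(s) f(s,t) ds = 0 for every t > 0, then v(s) = 0 for every s > 0. Moreover, if W : (0,∞) → (0,∞) is measurable, bounded and strictly positive, and ∫₀^∞ W(s) v(s) f(s,t) ds = 0 for every t > 0, then v(s) = 0 for every s > 0; that is, the subordination operator S_Φ and the weighted subordination operator S_{Φ,W} are injective. -/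
open MeasureTheory Set Filter
open scoped Topology

open ProbabilityTheory in
/-- Two finite measures on `ℝ` whose moment-generating functions exist and agree on a half-line
`(-∞, a)` with `0 < a` are equal. -/
theorem MeasureTheory.Measure.ext_of_mgf_id_eqOn_Iio {P Q : Measure ℝ} [IsFiniteMeasure P]
    [IsFiniteMeasure Q] {a : ℝ} (ha : 0 < a) (hP : Iio a ⊆ integrableExpSet id P)
    (hQ : Iio a ⊆ integrableExpSet id Q) (h : EqOn (mgf id P) (mgf id Q) (Iio a)) : P = Q := by
  have hsub {R : Measure ℝ} (hR : Iio a ⊆ integrableExpSet id R) :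
      {z : ℂ | z.re < a} ⊆ {z | z.re ∈ interior (integrableExpSet id R)} :=
    fun z hz ↦ interior_maximal hR isOpen_Iio hz
  have hpre : IsPreconnected {z : ℂ | z.re < a} := (convex_halfSpace_re_lt a).isPreconnected
  have hfreq : ∃ᶠ z in 𝓝[≠] (0 : ℂ), complexMGF id P z = complexMGF id Q z := by
    have hreal : ∃ᶠ x : ℝ in 𝓝[≠] 0, complexMGF id P x = complexMGF id Q x := by
      refine Eventually.frequently (eventually_nhdsWithin_of_eventually_nhds ?_)
      filter_upwards [Iio_mem_nhds ha] with x hx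
      rw [complexMGF_ofReal, complexMGF_ofReal, h hx]
    refine Tendsto.frequently ?_ hreal
    refine tendsto_nhdsWithin_iff.mpr ⟨?_, ?_⟩
    · exact (Complex.continuous_ofReal.tendsto' 0 0 Complex.ofReal_zero).mono_left
        nhdsWithin_le_nhds
    · filter_upwards [self_mem_nhdsWithin] with x hx
      simpa using hx
  have heq := (analyticOnNhd_complexMGF.mono (hsub hP)).eqOn_of_preconnected_of_frequently_eq
    (analyticOnNhd_complexMGF.mono (hsub hQ)) hpre (z₀ := 0) (by simpa using ha) hfreq
  refine Measure.ext_of_charFun (funext fun t ↦ ?_)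
  rw [← complexMGF_id_mul_I, ← complexMGF_id_mul_I]
  exact heq (by simpa using ha)

/-- A function whose two-sided Laplace transform vanishes on a half-line `(-∞, a)` with `0 < a`
vanishes almost everywhere. -/
theorem ae_eq_zero_of_integral_exp_mul_eq_zero {μ : Measure ℝ} {g : ℝ → ℝ} {a : ℝ} (ha : 0 < a)
    (hg : ∀ x < a, Integrable (fun s ↦ g s * Real.exp (x * s)) μ)
    (h : ∀ x < a, ∫ s, g s * Real.exp (x * s) ∂μ = 0) : g =ᵐ[μ] 0 := by
  have hint : Integrable g μ := by simpa using hg 0 ha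
  have hfin₁ := isFiniteMeasure_withDensity_ofReal hint.hasFiniteIntegral
  have hfin₂ := isFiniteMeasure_withDensity_ofReal hint.neg.hasFiniteIntegral
  have hm₁ : AEMeasurable (fun s ↦ ENNReal.ofReal (g s)) μ := hint.aemeasurable.ennreal_ofReal
  have hm₂ : AEMeasurable (fun s ↦ ENNReal.ofReal ((-g) s)) μ :=
    hint.neg.aemeasurable.ennreal_ofReal
  have hpos (x : ℝ) (hx : x < a) :
      Integrable (fun s ↦ max (g s) 0 * Real.exp (x * s)) μ := by
    refine (hg x hx).pos_part.congr (.of_forall fun s ↦ ?_)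
    simp [max_mul_of_nonneg, Real.exp_nonneg]
  have hneg (x : ℝ) (hx : x < a) :
      Integrable (fun s ↦ max ((-g) s) 0 * Real.exp (x * s)) μ := by
    refine (hg x hx).neg_part.congr (.of_forall fun s ↦ ?_)
    simp [max_mul_of_nonneg, Real.exp_nonneg]
  have heq : μ.withDensity (fun s ↦ ENNReal.ofReal (g s)) =
      μ.withDensity (fun s ↦ ENNReal.ofReal ((-g) s)) := by
    refine Measure.ext_of_mgf_id_eqOn_Iio ha (fun x hx ↦ ?_) (fun x hx ↦ ?_) fun x hx ↦ ?_
    · refine (integrable_withDensity_iff_integrable_smul₀' hm₁ (by simp)).mpr ?_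
      simpa [ENNReal.toReal_ofReal'] using hpos x hx
    · refine (integrable_withDensity_iff_integrable_smul₀' hm₂ (by simp)).mpr ?_
      simpa [ENNReal.toReal_ofReal'] using hneg x hx
    · rw [ProbabilityTheory.mgf, ProbabilityTheory.mgf,
        integral_withDensity_eq_integral_toReal_smul₀ hm₁ (by simp),
        integral_withDensity_eq_integral_toReal_smul₀ hm₂ (by simp)]
      simp only [ENNReal.toReal_ofReal', smul_eq_mul, id]
      rw [← sub_eq_zero, ← integral_sub (hpos x hx) (hneg x hx)]
      refine Eq.trans (integral_congr_ae (.of_forall fun s ↦ ?_)) (h x hx)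
      dsimp only
      rw [← sub_mul, Pi.neg_apply, max_zero_sub_max_neg_zero_eq_self]
  have hlt : ∫⁻ s, ENNReal.ofReal (g s) ∂μ ≠ ⊤ :=
    ((lintegral_mono fun s ↦ Real.ofReal_le_enorm (g s)).trans_lt hint.hasFiniteIntegral).ne
  filter_upwards [(withDensity_eq_iff hm₁ hm₂ hlt).mp heq] with s hs
  have := congrArg ENNReal.toReal hs
  simp only [ENNReal.toReal_ofReal', Pi.neg_apply] at this
  rw [Pi.zero_apply, ← max_zero_sub_max_neg_zero_eq_self (g s), this, sub_self]

/-- Injectivity of the Laplace transform on bounded functions on `(0, ∞)`. -/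
theorem ae_eq_zero_of_laplace_eq_zero {u : ℝ → ℝ} {C : ℝ}
    (hu : AEStronglyMeasurable u (volume.restrict (Ioi 0)))
    (hC : ∀ s ∈ Ioi (0 : ℝ), |u s| ≤ C)
    (h : ∀ y ∈ Ioi (0 : ℝ), ∫ s in Ioi (0 : ℝ), u s * Real.exp (-(s * y)) = 0) :
    u =ᵐ[volume.restrict (Ioi 0)] 0 := by
  have hrw (x s : ℝ) :
      u s * Real.exp (-s) * Real.exp (x * s) = u s * Real.exp (-(s * (1 - x))) := by
    rw [mul_assoc, ← Real.exp_add]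
    ring_nf
  have key := ae_eq_zero_of_integral_exp_mul_eq_zero (μ := volume.restrict (Ioi 0))
    (g := fun s ↦ u s * Real.exp (-s)) one_pos (fun x hx ↦ ?_) fun x hx ↦ ?_
  · filter_upwards [key] with s hs
    simpa using hs
  · simp only [hrw]
    have hexp : IntegrableOn (fun s ↦ Real.exp (-(s * (1 - x)))) (Ioi 0) := by
      refine (exp_neg_integrableOn_Ioi 0 (sub_pos.mpr hx)).congr_fun (fun s _ ↦ ?_)
        measurableSet_Ioi
      ring_nf
    exact hexp.bdd_mul hu ((ae_restrict_mem measurableSet_Ioi).mono hC)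
  · simp only [hrw]
    exact h _ (sub_pos.mpr hx)

/-- If a bounded function `u` is annihilated by the kernel `f`, whose Laplace transform in `t` is
`Φ l / l * exp (-(s * Φ l))`, then the Laplace transform of `u` vanishes on the range of `Φ`. -/
theorem laplace_eq_zero_of_subordination_eq_zero {Φ : ℝ → ℝ} {f : ℝ → ℝ → ℝ} {u : ℝ → ℝ} {C l : ℝ}
    (hl : 0 < l) (hΦl : 0 < Φ l) (hf_meas : Measurable (Function.uncurry f))
    (hf_nonneg : ∀ s ∈ Ioi (0 : ℝ), ∀ t ∈ Ioi (0 : ℝ), 0 ≤ f s t)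
    (hf_lap : ∀ s ∈ Ioi (0 : ℝ),
      ∫ t in Ioi (0 : ℝ), Real.exp (-(l * t)) * f s t = Φ l / l * Real.exp (-(s * Φ l)))
    (hu : AEStronglyMeasurable u (volume.restrict (Ioi 0)))
    (hC : ∀ s ∈ Ioi (0 : ℝ), |u s| ≤ C)
    (h : ∀ t ∈ Ioi (0 : ℝ), ∫ s in Ioi (0 : ℝ), u s * f s t = 0) :
    ∫ s in Ioi (0 : ℝ), u s * Real.exp (-(s * Φ l)) = 0 := by
  have hc : 0 < Φ l / l := div_pos hΦl hl
  have hint : Integrable (Function.uncurry fun s t ↦ u s * (Real.exp (-(l * t)) * f s t))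
      ((volume.restrict (Ioi 0)).prod (volume.restrict (Ioi 0))) := by
    have hmeas : AEStronglyMeasurable
        (Function.uncurry fun s t ↦ u s * (Real.exp (-(l * t)) * f s t))
        ((volume.restrict (Ioi (0 : ℝ))).prod (volume.restrict (Ioi (0 : ℝ)))) := by
      refine (hu.comp_fst (ν := volume.restrict (Ioi (0 : ℝ)))).mul
        (Measurable.aestronglyMeasurable ?_)
      exact (by fun_prop : Measurable fun p : ℝ × ℝ ↦ Real.exp (-(l * p.2))).mul hf_meas
    refine (integrable_prod_iff hmeas).mpr ⟨?_, ?_⟩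
    · filter_upwards [ae_restrict_mem measurableSet_Ioi] with s hs
      have hne : ∫ t in Ioi (0 : ℝ), Real.exp (-(l * t)) * f s t ≠ 0 := by
        rw [hf_lap s hs]
        positivity
      exact (Integrable.of_integral_ne_zero hne).const_mul (u s)
    · have hexp : IntegrableOn (fun s ↦ Φ l / l * Real.exp (-(s * Φ l))) (Ioi 0) := by
        refine IntegrableOn.congr_fun ((exp_neg_integrableOn_Ioi 0 hΦl).const_mul (Φ l / l))
          (fun s _ ↦ ?_) measurableSet_Ioi
        ring_nf
      refine Integrable.congr
        (hexp.bdd_mul hu.norm (c := C) ((ae_restrict_mem measurableSet_Ioi).mono ?_)) ?_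
      · simpa using hC
      · filter_upwards [ae_restrict_mem measurableSet_Ioi] with s hs
        rw [← hf_lap s hs, ← integral_const_mul]
        refine setIntegral_congr_fun measurableSet_Ioi fun t ht ↦ ?_
        simp [abs_of_nonneg (hf_nonneg s hs t ht)]
  have hswap := integral_integral_swap hint
  have hright : ∫ t in Ioi (0 : ℝ), ∫ s in Ioi (0 : ℝ), u s * (Real.exp (-(l * t)) * f s t) = 0 := by
    refine setIntegral_eq_zero_of_forall_eq_zero fun t ht ↦ ?_
    simp only [mul_left_comm (u _), integral_const_mul, h t ht, mul_zero]
  have hleft : ∫ s in Ioi (0 : ℝ), ∫ t in Ioi (0 : ℝ), u s * (Real.exp (-(l * t)) * f s t) =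
      Φ l / l * ∫ s in Ioi (0 : ℝ), u s * Real.exp (-(s * Φ l)) := by
    rw [← integral_const_mul]
    refine setIntegral_congr_fun measurableSet_Ioi fun s hs ↦ ?_
    simp only [integral_const_mul, hf_lap s hs]
    ring
  rw [hleft, hright] at hswap
  exact (mul_eq_zero.mp hswap).resolve_left hc.ne'

/-- Injectivity of the subordination operator `S_Φ` and of the weighted subordination
operator `S_{Φ,W}` on bounded continuous functions on `(0,∞)`. -/
theorem stmt_9 (Φ : ℝ → ℝ) (hΦ_pos : ∀ l ∈ Set.Ioi (0:ℝ), 0 < Φ l)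
    (hΦ_cont : ContinuousOn Φ (Set.Ioi 0)) (hΦ_mono : StrictMonoOn Φ (Set.Ioi 0))
    (hΦ_zero : Tendsto Φ (𝓝[>] (0:ℝ)) (𝓝 0)) (hΦ_top : Tendsto Φ atTop atTop)
    (f : ℝ → ℝ → ℝ) (hf_meas : Measurable (Function.uncurry f))
    (hf_nonneg : ∀ s ∈ Set.Ioi (0:ℝ), ∀ t ∈ Set.Ioi (0:ℝ), 0 ≤ f s t)
    (hf_prob : ∀ t ∈ Set.Ioi (0:ℝ), ∫ s in Set.Ioi (0:ℝ), f s t = 1)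
    (hf_lap : ∀ s ∈ Set.Ioi (0:ℝ), ∀ l ∈ Set.Ioi (0:ℝ),
      ∫ t in Set.Ioi (0:ℝ), Real.exp (-(l*t)) * f s t = Φ l / l * Real.exp (-(s * Φ l)))
    (v : ℝ → ℝ) (hv_cont : ContinuousOn v (Set.Ioi 0))
    (B : ℝ) (hv_bdd : ∀ s ∈ Set.Ioi (0:ℝ), |v s| ≤ B) :
    ((∀ t ∈ Set.Ioi (0:ℝ), ∫ s in Set.Ioi (0:ℝ), v s * f s t = 0) →
      ∀ s ∈ Set.Ioi (0:ℝ), v s = 0) ∧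
    (∀ W : ℝ → ℝ, Measurable W → (∀ s ∈ Set.Ioi (0:ℝ), 0 < W s) →
      (∃ MW, ∀ s ∈ Set.Ioi (0:ℝ), W s ≤ MW) →
      (∀ t ∈ Set.Ioi (0:ℝ), ∫ s in Set.Ioi (0:ℝ), W s * v s * f s t = 0) →
      ∀ s ∈ Set.Ioi (0:ℝ), v s = 0) := by
  have hsurj : ∀ y ∈ Ioi (0 : ℝ), ∃ l ∈ Ioi (0 : ℝ), Φ l = y := fun y hy ↦ by
    have himg := isPreconnected_Ioi.intermediate_value_Ioi (l₁ := 𝓝[>] (0 : ℝ)) (l₂ := atTop)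
      inf_le_right (le_principal_iff.mpr (Ioi_mem_atTop 0)) hΦ_cont hΦ_zero hΦ_top
    exact himg hy
  have key : ∀ u : ℝ → ℝ, ∀ C : ℝ, AEStronglyMeasurable u (volume.restrict (Ioi 0)) →
      (∀ s ∈ Ioi (0 : ℝ), |u s| ≤ C) →
      (∀ t ∈ Ioi (0 : ℝ), ∫ s in Ioi (0 : ℝ), u s * f s t = 0) →
      u =ᵐ[volume.restrict (Ioi 0)] 0 := fun u C hu hC h ↦ by
    refine ae_eq_zero_of_laplace_eq_zero hu hC fun y hy ↦ ?_
    obtain ⟨l, hl, rfl⟩ := hsurj y hy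
    exact laplace_eq_zero_of_subordination_eq_zero hl (hΦ_pos l hl) hf_meas hf_nonneg
      (fun s hs ↦ hf_lap s hs l hl) hu hC h
  have hv_meas := hv_cont.aestronglyMeasurable (μ := volume) measurableSet_Ioi
  have hv_zero (h : v =ᵐ[volume.restrict (Ioi 0)] 0) : ∀ s ∈ Ioi (0 : ℝ), v s = 0 :=
    Measure.eqOn_open_of_ae_eq h isOpen_Ioi hv_cont continuousOn_const
  refine ⟨fun h ↦ hv_zero (key v B hv_meas hv_bdd h), ?_⟩
  rintro W hW_meas hW_pos ⟨M, hM⟩ h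
  refine hv_zero ?_
  have hWv := key (fun s ↦ W s * v s) (M * B) (hW_meas.aestronglyMeasurable.mul hv_meas)
    (fun s hs ↦ ?_) h
  · filter_upwards [hWv, ae_restrict_mem measurableSet_Ioi] with s hs hs_pos
    exact (mul_eq_zero.mp hs).resolve_left (hW_pos s hs_pos).ne'
  · rw [abs_mul, abs_of_pos (hW_pos s hs)]
    exact mul_le_mul (hM s hs) (hv_bdd s hs) (abs_nonneg _) ((hW_pos s hs).le.trans (hM s hs))
end

section
/- Let α ∈ (0,1), β ∈ ((α−1)/α, 2), C > 0, and let g : (0,∞) → [0,∞) be measurable with ∫₀^∞ g(w) dw = 1 and ∫₀^∞ w^{α(β−1)} g(w) dw < ∞. Let v : (0,∞) → ℝ be bounded, continuously differentiable, with |v'(t)| ≤ C t^{−β} for all t > 0. Then the function F(t) = ∫₀^∞ v((t/w)^α) g(w) dw is continuously differentiable on (0,∞) and F'(t) = (α/t) ∫₀^∞ (t/w)^α v'((t/w)^α) g(w) dw for every t > 0. -/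
open MeasureTheory Set Filter
open scoped Topology

lemma abs_rpow_mul_deriv_le {α β C : ℝ} {v' : ℝ → ℝ}
    (hv' : ∀ t ∈ Set.Ioi (0:ℝ), |v' t| ≤ C * t ^ (-β)) {t w : ℝ} (ht : 0 < t) (hw : 0 < w) :
    |(t/w) ^ α * v' ((t/w) ^ α)| ≤ C * t ^ (α * (1 - β)) * w ^ (α * (β - 1)) := by
  have hs : 0 < t / w := div_pos ht hw
  have hsa : 0 < (t / w) ^ α := Real.rpow_pos_of_pos hs α
  calc |(t/w) ^ α * v' ((t/w) ^ α)| = (t/w) ^ α * |v' ((t/w) ^ α)| := by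
        rw [abs_mul, abs_of_pos hsa]
    _ ≤ (t/w) ^ α * (C * ((t/w) ^ α) ^ (-β)) := by gcongr; exact hv' _ hsa
    _ = C * (t/w) ^ (α * (1 - β)) := by
        rw [← Real.rpow_mul hs.le, mul_left_comm, ← Real.rpow_add hs]
        ring_nf
    _ = C * t ^ (α * (1 - β)) * w ^ (α * (β - 1)) := by
        rw [Real.div_rpow ht.le hw.le, div_eq_mul_inv, ← Real.rpow_neg hw.le]
        ring_nf

lemma continuousOn_div_rpow_const {t : ℝ} (ht : 0 < t) (α : ℝ) :
    ContinuousOn (fun w : ℝ => (t / w) ^ α) (Set.Ioi 0) := by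
  refine ContinuousOn.rpow_const ?_ fun w hw => Or.inl (div_pos ht hw).ne'
  exact continuousOn_const.div continuousOn_id fun w hw => (ne_of_gt hw)

lemma aestronglyMeasurable_comp_div_rpow {t : ℝ} (ht : 0 < t) (α : ℝ) {u g : ℝ → ℝ}
    (hu : ContinuousOn u (Set.Ioi 0)) (hg : Measurable g) :
    AEStronglyMeasurable (fun w => u ((t/w) ^ α) * g w) (volume.restrict (Set.Ioi 0)) := by
  refine AEStronglyMeasurable.mul ?_ hg.aestronglyMeasurable
  refine ContinuousOn.aestronglyMeasurable ?_ measurableSet_Ioi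
  exact hu.comp (continuousOn_div_rpow_const ht α)
    fun w hw => Real.rpow_pos_of_pos (div_pos ht hw) α

/-- Locally uniform domination of the integrands `(t/w)^α v'((t/w)^α) g(w)`. -/
lemma exists_bound_rpow_mul_deriv {α β C : ℝ} {g v' : ℝ → ℝ}
    (hC : 0 < C) (hg : ∀ w ∈ Set.Ioi (0:ℝ), 0 ≤ g w)
    (hv' : ∀ t ∈ Set.Ioi (0:ℝ), |v' t| ≤ C * t ^ (-β)) {t₀ : ℝ} (ht₀ : 0 < t₀) :
    ∃ K : ℝ, ∀ t ∈ Set.Ioo (t₀ / 2) (2 * t₀), ∀ w ∈ Set.Ioi (0:ℝ),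
      ‖(t/w) ^ α * v' ((t/w) ^ α) * g w‖ ≤ K * (w ^ (α * (β - 1)) * g w) := by
  have hcont : ContinuousOn (fun t : ℝ => t ^ (α * (1 - β))) (Set.Icc (t₀ / 2) (2 * t₀)) :=
    continuousOn_id.rpow_const fun t ht => Or.inl (by
      have := ht.1
      simp only [id]
      linarith)
  obtain ⟨M, hM⟩ := isCompact_Icc.exists_bound_of_continuousOn hcont
  refine ⟨C * M, fun t ht w hw => ?_⟩
  have htpos : 0 < t := by linarith [ht.1]
  have h := abs_rpow_mul_deriv_le (α := α) hv' htpos hw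
  have hMt : t ^ (α * (1 - β)) ≤ M := (le_abs_self _).trans (hM t ⟨ht.1.le, ht.2.le⟩)
  have hwpos : 0 ≤ w ^ (α * (β - 1)) := Real.rpow_nonneg (le_of_lt hw) _
  have hgw := hg w hw
  rw [norm_mul, Real.norm_eq_abs, Real.norm_of_nonneg hgw, ← mul_assoc]
  refine mul_le_mul_of_nonneg_right (h.trans ?_) hgw
  gcongr

/-- Differentiability of the α-stable subordinated function: under the growth condition
`|v'(t)| ≤ C t^{−β}`, the function `F(t) = ∫₀^∞ v((t/w)^α) g(w) dw` is continuously
differentiable on `(0,∞)` with `F'(t) = (α/t) ∫₀^∞ (t/w)^α v'((t/w)^α) g(w) dw`. -/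
theorem stmt_11 (α β C : ℝ) (hα : α ∈ Set.Ioo (0:ℝ) 1)
    (hβ : β ∈ Set.Ioo ((α - 1)/α) 2) (hC : 0 < C)
    (g : ℝ → ℝ) (hg_meas : Measurable g) (hg_nonneg : ∀ w ∈ Set.Ioi (0:ℝ), 0 ≤ g w)
    (hg_prob : ∫ w in Set.Ioi (0:ℝ), g w = 1)
    (hg_mom : IntegrableOn (fun w => w ^ (α*(β - 1)) * g w) (Set.Ioi 0))
    (v v' : ℝ → ℝ) (B : ℝ) (hv_bdd : ∀ t ∈ Set.Ioi (0:ℝ), |v t| ≤ B)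
    (hv_deriv : ∀ t ∈ Set.Ioi (0:ℝ), HasDerivAt v (v' t) t)
    (hv'_cont : ContinuousOn v' (Set.Ioi 0))
    (hv'_bdd : ∀ t ∈ Set.Ioi (0:ℝ), |v' t| ≤ C * t ^ (-β))
    (F : ℝ → ℝ) (hF : ∀ t, F t = ∫ w in Set.Ioi (0:ℝ), v ((t/w) ^ α) * g w) :
    (∀ t ∈ Set.Ioi (0:ℝ), HasDerivAt F
      (α / t * ∫ w in Set.Ioi (0:ℝ), (t/w) ^ α * v' ((t/w) ^ α) * g w) t) ∧
    ContinuousOn (fun t => α / t * ∫ w in Set.Ioi (0:ℝ), (t/w) ^ α * v' ((t/w) ^ α) * g w)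
      (Set.Ioi 0) := by
  have hg_int : IntegrableOn g (Set.Ioi 0) := by
    by_contra h
    rw [integral_undef h] at hg_prob
    exact zero_ne_one hg_prob
  have hv_cont : ContinuousOn v (Set.Ioi 0) :=
    fun t ht => (hv_deriv t ht).continuousAt.continuousWithinAt
  have hu_cont : ContinuousOn (fun z => z * v' z) (Set.Ioi 0) := continuousOn_id.mul hv'_cont
  have hnhds : ∀ t : ℝ, 0 < t → Set.Ioo (t / 2) (2 * t) ∈ 𝓝 t :=
    fun t ht => Ioo_mem_nhds (by linarith) (by linarith)
  refine ⟨fun t₀ ht₀ => ?_, ?_⟩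
  · have ht₀ : 0 < t₀ := ht₀
    obtain ⟨K, hK⟩ := exists_bound_rpow_mul_deriv (α := α) hC hg_nonneg hv'_bdd ht₀
    have key := (hasDerivAt_integral_of_dominated_loc_of_deriv_le
      (μ := volume.restrict (Set.Ioi (0:ℝ))) (x₀ := t₀)
      (F := fun t w => v ((t/w) ^ α) * g w)
      (F' := fun t w => α / t * ((t/w) ^ α * v' ((t/w) ^ α) * g w))
      (bound := fun w => α / (t₀ / 2) * (K * (w ^ (α * (β - 1)) * g w)))
      (hnhds t₀ ht₀) ?_ ?_ ?_ ?_ ?_ ?_).2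
    · rw [funext hF, ← integral_const_mul]
      exact key
    · filter_upwards [lt_mem_nhds ht₀] with t ht
      exact aestronglyMeasurable_comp_div_rpow ht α hv_cont hg_meas
    · refine Integrable.mono' (hg_int.const_mul B)
        (aestronglyMeasurable_comp_div_rpow ht₀ α hv_cont hg_meas) ?_
      filter_upwards [ae_restrict_mem measurableSet_Ioi] with w hw
      rw [norm_mul, Real.norm_of_nonneg (hg_nonneg w hw)]
      exact mul_le_mul_of_nonneg_right
        (hv_bdd _ (Real.rpow_pos_of_pos (div_pos ht₀ hw) α)) (hg_nonneg w hw)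
    · exact (aestronglyMeasurable_comp_div_rpow ht₀ α hu_cont hg_meas).const_mul _
    · filter_upwards [ae_restrict_mem measurableSet_Ioi] with w hw t ht
      have htpos : 0 < t := by linarith [ht.1]
      have hα0 := hα.1
      rw [norm_mul, Real.norm_of_nonneg (div_pos hα0 htpos).le]
      have hlt := ht.1
      exact mul_le_mul (by gcongr) (hK t ht w hw) (norm_nonneg _) (by positivity)
    · exact (hg_mom.const_mul K).const_mul _
    · filter_upwards [ae_restrict_mem measurableSet_Ioi] with w hw t ht
      have htpos : 0 < t := by linarith [ht.1]
      have hw : 0 < w := hw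
      have hs : 0 < t / w := div_pos htpos hw
      have h1 : HasDerivAt (fun t : ℝ => (t / w) ^ α) (1 / w * α * (t / w) ^ (α - 1)) t :=
        ((hasDerivAt_id t).div_const w).rpow_const (Or.inl hs.ne')
      have h2 := ((hv_deriv _ (Real.rpow_pos_of_pos hs α)).comp t h1).mul_const (g w)
      refine h2.congr_deriv ?_
      rw [Real.rpow_sub_one hs.ne']
      field_simp
  · intro t₀ ht₀
    have ht₀ : 0 < t₀ := ht₀
    obtain ⟨K, hK⟩ := exists_bound_rpow_mul_deriv (α := α) hC hg_nonneg hv'_bdd ht₀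
    refine ContinuousAt.continuousWithinAt ?_
    refine (continuousAt_const.div continuousAt_id ht₀.ne').mul ?_
    refine continuousAt_of_dominated (bound := fun w => K * (w ^ (α * (β - 1)) * g w))
      ?_ ?_ (hg_mom.const_mul K) ?_
    · filter_upwards [lt_mem_nhds ht₀] with t ht
      exact aestronglyMeasurable_comp_div_rpow ht α hu_cont hg_meas
    · filter_upwards [hnhds t₀ ht₀] with t ht
      filter_upwards [ae_restrict_mem measurableSet_Ioi] with w hw
      exact hK t ht w hw
    · filter_upwards [ae_restrict_mem measurableSet_Ioi] with w hw
      have hs : 0 < t₀ / w := div_pos ht₀ hw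
      have h1 : ContinuousAt (fun t : ℝ => (t / w) ^ α) t₀ :=
        (continuousAt_id.div_const w).rpow_const (Or.inl hs.ne')
      have h2 : ContinuousAt (fun z => z * v' z) ((t₀ / w) ^ α) :=
        hu_cont.continuousAt (Ioi_mem_nhds (Real.rpow_pos_of_pos hs α))
      exact (ContinuousAt.comp (f := fun t : ℝ => (t / w) ^ α) h2 h1).mul continuousAt_const
end

section
/- Let Φ : (0,∞) → (0,∞), let ν̄ : (0,∞) → [0,∞) be measurable with ∫₀^∞ e^{−λt} ν̄(t) dt = Φ(λ)/λ for every λ > 0, and let f : (0,∞) × (0,∞) → [0,∞) be measurable with ∫₀^∞ f(s,t) ds = 1 for every t > 0 and ∫₀^∞ e^{−λt} f(s,t) dt = (Φ(λ)/λ) e^{−sΦ(λ)} for every s > 0 and λ > 0. Let v : [0,∞) → ℝ be continuously differentiable with v and v' bounded. Set v_Φ(t) = ∫₀^∞ v(s) f(s,t) ds and G(t) = ∫₀^∞ v'(s) f(s,t) ds. Then for almost every t > 0, ∫₀^t ν̄(t−s)(v_Φ(s) − v(0)) ds = ∫₀^t G(s) ds; consequently, wherever the left-hand side is differentiable, the Caputo-type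 derivative ∂^Φ v_Φ(t) = d/dt ∫₀^t ν̄(t−s)(v_Φ(s) − v(0)) ds equals S_Φ(v')(t). -/
open MeasureTheory Set Filter
open scoped Topology

namespace ProbabilityTheory

/-- Two finite measures on `ℝ` whose moment-generating functions are finite and coincide on an open
convex neighbourhood of `0` are equal. -/
theorem Measure.ext_of_eqOn_mgf_id {μ μ' : Measure ℝ} [IsFiniteMeasure μ] [IsFiniteMeasure μ']
    {S : Set ℝ} (hS : IsOpen S) (hSc : Convex ℝ S) (h0 : (0 : ℝ) ∈ S)
    (hμ : S ⊆ integrableExpSet id μ) (hμ' : S ⊆ integrableExpSet id μ')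
    (h : EqOn (mgf id μ) (mgf id μ') S) : μ = μ' := by
  have hX : AnalyticOnNhd ℂ (complexMGF id μ) {z | z.re ∈ S} :=
    analyticOnNhd_complexMGF.mono fun z hz => interior_maximal hμ hS hz
  have hY : AnalyticOnNhd ℂ (complexMGF id μ') {z | z.re ∈ S} :=
    analyticOnNhd_complexMGF.mono fun z hz => interior_maximal hμ' hS hz
  have key : EqOn (complexMGF id μ) (complexMGF id μ') {z | z.re ∈ S} := by
    refine AnalyticOnNhd.eqOn_of_preconnected_of_frequently_eq hX hY
      (hSc.linear_preimage Complex.reLm).isPreconnected (z₀ := 0) (by simpa using h0) ?_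
    have ht : Tendsto ((↑) : ℝ → ℂ) (𝓝[≠] 0) (𝓝[≠] 0) := by
      refine tendsto_nhdsWithin_iff.2 ⟨?_, ?_⟩
      · exact (Complex.continuous_ofReal.tendsto' 0 0 (by simp)).mono_left nhdsWithin_le_nhds
      · filter_upwards [self_mem_nhdsWithin] with x hx
        simpa using hx
    refine ht.frequently (Eventually.frequently ?_)
    filter_upwards [nhdsWithin_le_nhds (hS.mem_nhds h0)] with x hx
    rw [complexMGF_ofReal, complexMGF_ofReal, h hx]
  refine Measure.ext_of_charFun (funext fun t => ?_)
  rw [← complexMGF_id_mul_I, ← complexMGF_id_mul_I]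
  exact key (by simpa using h0)

end ProbabilityTheory

/-- A function on `(0, ∞)` whose Laplace transform converges absolutely and vanishes on `(0, ∞)`
is zero almost everywhere. -/
theorem ae_eq_zero_of_laplace_eq_zero_s13 {h : ℝ → ℝ}
    (hint : ∀ l > 0, IntegrableOn (fun t => Real.exp (-(l * t)) * h t) (Ioi 0))
    (hzero : ∀ l > 0, ∫ t in Ioi (0 : ℝ), Real.exp (-(l * t)) * h t = 0) :
    ∀ᵐ t ∂(volume.restrict (Ioi (0 : ℝ))), h t = 0 := by
  set k : ℝ → ℝ := fun t => Real.exp (-(1 * t)) * h t with hk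
  have hki : Integrable k (volume.restrict (Ioi 0)) := hint 1 one_pos
  have hmul (t x : ℝ) : k x * Real.exp (t * x) = Real.exp (-((1 - t) * x)) * h x := by
    rw [hk]
    dsimp only
    rw [mul_right_comm, ← Real.exp_add]
    ring_nf
  have hkt (t : ℝ) (ht : t < 1) :
      Integrable (fun x => k x * Real.exp (t * x)) (volume.restrict (Ioi 0)) := by
    simp_rw [hmul]
    exact hint _ (sub_pos.2 ht)
  have hdens (g : ℝ → ℝ) (hg : Integrable g (volume.restrict (Ioi 0)))
      (hgt : ∀ t < 1, Integrable (fun x => g x * Real.exp (t * x)) (volume.restrict (Ioi 0))) :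
      Iio 1 ⊆ ProbabilityTheory.integrableExpSet id
        ((volume.restrict (Ioi 0)).withDensity fun x => ENNReal.ofReal (g x)) := by
    intro t ht
    rw [ProbabilityTheory.integrableExpSet, mem_ofPred_eq,
      integrable_withDensity_iff_integrable_smul₀' hg.aemeasurable.ennreal_ofReal (by simp)]
    refine (hgt t ht).mono ?_ (ae_of_all _ fun x => ?_)
    · exact (hg.aemeasurable.ennreal_ofReal.ennreal_toReal.mul
        (by fun_prop)).aestronglyMeasurable
    · simp only [id, smul_eq_mul, norm_mul]
      gcongr
      rw [ENNReal.toReal_ofReal', Real.norm_eq_abs, Real.norm_eq_abs, abs_of_nonneg (by simp)]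
      exact max_le (le_abs_self _) (abs_nonneg _)
  have hpos := hdens k hki hkt
  have hneg := hdens (fun x => -k x) hki.neg fun t ht => by
    simpa only [neg_mul] using! (hkt t ht).neg
  have : IsFiniteMeasure ((volume.restrict (Ioi 0)).withDensity fun x => ENNReal.ofReal (k x)) :=
    isFiniteMeasure_withDensity_ofReal hki.2
  have : IsFiniteMeasure ((volume.restrict (Ioi 0)).withDensity fun x => ENNReal.ofReal (-k x)) :=
    isFiniteMeasure_withDensity_ofReal hki.neg.2
  have heq := ProbabilityTheory.Measure.ext_of_eqOn_mgf_id isOpen_Iio (convex_Iio 1)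
    (mem_Iio.2 one_pos) hpos hneg fun t ht => by
      have h1 := hpos ht
      have h2 := hneg ht
      rw [ProbabilityTheory.integrableExpSet, mem_ofPred_eq,
        integrable_withDensity_iff_integrable_smul₀' (by fun_prop) (by simp)] at h1 h2
      rw [ProbabilityTheory.mgf, ProbabilityTheory.mgf,
        integral_withDensity_eq_integral_toReal_smul₀ (by fun_prop) (by simp),
        integral_withDensity_eq_integral_toReal_smul₀ (by fun_prop) (by simp),
        ← sub_eq_zero, ← integral_sub h1 h2]
      refine Eq.trans (integral_congr_ae (ae_of_all _ fun x => ?_)) (hzero (1 - t) (sub_pos.2 ht))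
      simp only [id, smul_eq_mul]
      rw [← hmul, ← sub_mul, ENNReal.toReal_ofReal', ENNReal.toReal_ofReal',
        max_zero_sub_max_neg_zero_eq_self]
  rw [withDensity_eq_iff (by fun_prop) (by fun_prop) hki.lintegral_lt_top.ne] at heq
  filter_upwards [heq] with x hx
  have hx0 : k x = 0 := by
    rcases le_total (k x) 0 with h' | h'
    · rw [ENNReal.ofReal_of_nonpos h', eq_comm, ENNReal.ofReal_eq_zero] at hx
      linarith
    · rw [ENNReal.ofReal_of_nonpos (neg_nonpos.2 h'), ENNReal.ofReal_eq_zero] at hx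
      linarith
  simpa [hk] using hx0

/-- The Laplace transform of a convolution on `(0, ∞)` is the product of the Laplace transforms. -/
theorem laplace_convolution {a b : ℝ → ℝ} {l : ℝ}
    (ha : IntegrableOn (fun t => Real.exp (-(l * t)) * a t) (Ioi 0))
    (hb : IntegrableOn (fun t => Real.exp (-(l * t)) * b t) (Ioi 0)) :
    IntegrableOn (fun t => Real.exp (-(l * t)) * ∫ s in (0 : ℝ)..t, b (t - s) * a s) (Ioi 0) ∧
    ∫ t in Ioi (0 : ℝ), Real.exp (-(l * t)) * ∫ s in (0 : ℝ)..t, b (t - s) * a s =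
      (∫ t in Ioi (0 : ℝ), Real.exp (-(l * t)) * a t) *
        ∫ t in Ioi (0 : ℝ), Real.exp (-(l * t)) * b t := by
  have hconv (t : ℝ) : Real.exp (-(l * t)) * ∫ s in (0 : ℝ)..t, b (t - s) * a s =
      ∫ s in (0 : ℝ)..t, ContinuousLinearMap.mul ℝ ℝ (Real.exp (-(l * s)) * a s)
        (Real.exp (-(l * (t - s))) * b (t - s)) := by
    rw [← intervalIntegral.integral_const_mul]
    refine intervalIntegral.integral_congr fun s _ => ?_
    have : Real.exp (-(l * t)) = Real.exp (-(l * s)) * Real.exp (-(l * (t - s))) := by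
      rw [← Real.exp_add]
      ring_nf
    simp only [ContinuousLinearMap.mul_apply', this]
    ring
  simp_rw [hconv]
  refine ⟨?_, integral_posConvolution ha hb (ContinuousLinearMap.mul ℝ ℝ)⟩
  exact (integrable_indicator_iff measurableSet_Ioi).1
    (integrable_posConvolution ha hb (ContinuousLinearMap.mul ℝ ℝ))

/-- The Laplace transform of `t ↦ ∫ w(s) f(s,t) ds` for bounded `w` and a family `f(·,t)` of
probability densities is the integral of `w` against the Laplace transform of `f(s,·)`. -/
theorem laplace_integral_density {f : ℝ → ℝ → ℝ} (hf_meas : Measurable (Function.uncurry f))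
    (hf_nonneg : ∀ s ∈ Ioi (0 : ℝ), ∀ t ∈ Ioi (0 : ℝ), 0 ≤ f s t)
    (hf_prob : ∀ t ∈ Ioi (0 : ℝ), ∫ s in Ioi (0 : ℝ), f s t = 1)
    {w : ℝ → ℝ} (hw : ContinuousOn w (Ici 0)) {B : ℝ} (hB : ∀ s ∈ Ici (0 : ℝ), |w s| ≤ B)
    {l : ℝ} (hl : 0 < l) :
    IntegrableOn (fun t => Real.exp (-(l * t)) * ∫ s in Ioi (0 : ℝ), w s * f s t) (Ioi 0) ∧
    ∫ t in Ioi (0 : ℝ), Real.exp (-(l * t)) * ∫ s in Ioi (0 : ℝ), w s * f s t =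
      ∫ s in Ioi (0 : ℝ), w s * ∫ t in Ioi (0 : ℝ), Real.exp (-(l * t)) * f s t := by
  have hK : Integrable (fun p : ℝ × ℝ => Real.exp (-(l * p.1)) * f p.2 p.1)
      ((volume.restrict (Ioi 0)).prod (volume.restrict (Ioi 0))) := by
    have hm : Measurable fun p : ℝ × ℝ => Real.exp (-(l * p.1)) * f p.2 p.1 :=
      (by fun_prop : Measurable fun p : ℝ × ℝ => Real.exp (-(l * p.1))).mul
        (hf_meas.comp measurable_swap)
    rw [integrable_prod_iff hm.aestronglyMeasurable]
    constructor
    · filter_upwards [ae_restrict_mem measurableSet_Ioi] with t ht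
      refine Integrable.const_mul ?_ _
      exact not_imp_comm.1 integral_undef (by rw [hf_prob t ht]; exact one_ne_zero)
    · have he : IntegrableOn (fun t => Real.exp (-l * t)) (Ioi 0) := exp_neg_integrableOn_Ioi 0 hl
      refine he.congr_fun (fun t ht => ?_) measurableSet_Ioi
      rw [setIntegral_congr_fun (g := fun s => Real.exp (-(l * t)) * f s t) measurableSet_Ioi,
        integral_const_mul, hf_prob t ht, mul_one]
      · simp only [neg_mul]
      intro s hs
      simp only [norm_mul, Real.norm_eq_abs, Real.abs_exp, abs_of_nonneg (hf_nonneg s hs t ht)]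
  have hwK : Integrable (fun p : ℝ × ℝ => w p.2 * (Real.exp (-(l * p.1)) * f p.2 p.1))
      ((volume.restrict (Ioi 0)).prod (volume.restrict (Ioi 0))) := by
    refine hK.bdd_mul (c := B) ?_ ?_
    · exact ((hw.mono Ioi_subset_Ici_self).aestronglyMeasurable measurableSet_Ioi).comp_snd
    · rw [Measure.prod_restrict]
      filter_upwards [ae_restrict_mem (measurableSet_Ioi.prod measurableSet_Ioi)] with p hp
      exact hB _ (Ioi_subset_Ici_self hp.2)
  have hin (t : ℝ) : ∫ s in Ioi (0 : ℝ), w s * (Real.exp (-(l * t)) * f s t) =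
      Real.exp (-(l * t)) * ∫ s in Ioi (0 : ℝ), w s * f s t := by
    rw [← integral_const_mul]
    simp only [mul_left_comm]
  simp_rw [← hin, ← integral_const_mul]
  exact ⟨hwK.integral_prod_left, integral_integral_swap hwK⟩

/-- The Laplace transform of the derivative of a bounded function with bounded derivative. -/
theorem laplace_deriv {v v' : ℝ → ℝ}
    (hv_deriv : ∀ t ∈ Ici (0 : ℝ), HasDerivWithinAt v (v' t) (Ici 0) t)
    (hv'_cont : ContinuousOn v' (Ici 0))
    {Bv : ℝ} (hv_bdd : ∀ t ∈ Ici (0 : ℝ), |v t| ≤ Bv)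
    {Bv' : ℝ} (hv'_bdd : ∀ t ∈ Ici (0 : ℝ), |v' t| ≤ Bv') {p : ℝ} (hp : 0 < p) :
    ∫ s in Ioi (0 : ℝ), v' s * Real.exp (-(s * p)) =
      p * (∫ s in Ioi (0 : ℝ), v s * Real.exp (-(s * p))) - v 0 := by
  have hv_cont : ContinuousOn v (Ici 0) := fun t ht => (hv_deriv t ht).continuousWithinAt
  have hint {w : ℝ → ℝ} {B : ℝ} (hw : ContinuousOn w (Ici 0))
      (hB : ∀ t ∈ Ici (0 : ℝ), |w t| ≤ B) :
      IntegrableOn (fun s => w s * Real.exp (-(s * p))) (Ioi 0) := by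
    have he : IntegrableOn (fun s => Real.exp (-(s * p))) (Ioi 0) := by
      simpa only [neg_mul, mul_comm p] using exp_neg_integrableOn_Ioi 0 hp
    refine Integrable.bdd_mul (c := B) he
      ((hw.mono Ioi_subset_Ici_self).aestronglyMeasurable measurableSet_Ioi) ?_
    filter_upwards [ae_restrict_mem measurableSet_Ioi] with s hs
    exact hB s (Ioi_subset_Ici_self hs)
  have h1 := hint hv_cont hv_bdd
  have h2 := hint hv'_cont hv'_bdd
  have hlim : Tendsto (fun s => v s * Real.exp (-(s * p))) atTop (𝓝 0) := by
    have he : Tendsto (fun s : ℝ => Real.exp (-(s * p))) atTop (𝓝 0) :=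
      Real.tendsto_exp_neg_atTop_nhds_zero.comp (tendsto_id.atTop_mul_const hp)
    refine bdd_le_mul_tendsto_zero' Bv ?_ he
    filter_upwards [Ici_mem_atTop 0] with s hs using hv_bdd s hs
  have key := integral_Ioi_of_hasDerivAt_of_tendsto (a := 0)
    (f := fun s => v s * Real.exp (-(s * p)))
    (f' := fun s => v' s * Real.exp (-(s * p)) - p * (v s * Real.exp (-(s * p))))
    ((hv_cont 0 self_mem_Ici).mul (by fun_prop))
    (fun s hs => by
      have hd := ((hv_deriv s (Ioi_subset_Ici_self hs)).hasDerivAt (Ici_mem_nhds hs)).mul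
        ((hasDerivAt_id s).mul_const p).neg.exp
      convert! hd using 1
      simp only [id, Pi.neg_apply]
      ring)
    (h2.sub (h1.const_mul p)) hlim
  rw [integral_sub h2 (h1.const_mul p), integral_const_mul] at key
  simp only [zero_mul, neg_zero, Real.exp_zero, mul_one] at key
  linarith

/-- The Caputo-type derivative of the subordinated function is the subordination of the
ordinary derivative: for a.e. `t > 0`,
`∫₀^t ν̄(t−s)(v_Φ(s) − v(0)) ds = ∫₀^t S_Φ(v')(s) ds`. -/
theorem stmt_13 (Φ nu : ℝ → ℝ) (hΦ_pos : ∀ l ∈ Set.Ioi (0:ℝ), 0 < Φ l)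
    (hnu_meas : Measurable nu) (hnu_nonneg : ∀ t ∈ Set.Ioi (0:ℝ), 0 ≤ nu t)
    (hnu_lap : ∀ l ∈ Set.Ioi (0:ℝ),
      ∫ t in Set.Ioi (0:ℝ), Real.exp (-(l*t)) * nu t = Φ l / l)
    (f : ℝ → ℝ → ℝ) (hf_meas : Measurable (Function.uncurry f))
    (hf_nonneg : ∀ s ∈ Set.Ioi (0:ℝ), ∀ t ∈ Set.Ioi (0:ℝ), 0 ≤ f s t)
    (hf_prob : ∀ t ∈ Set.Ioi (0:ℝ), ∫ s in Set.Ioi (0:ℝ), f s t = 1)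
    (hf_lap : ∀ s ∈ Set.Ioi (0:ℝ), ∀ l ∈ Set.Ioi (0:ℝ),
      ∫ t in Set.Ioi (0:ℝ), Real.exp (-(l*t)) * f s t = Φ l / l * Real.exp (-(s * Φ l)))
    (v v' : ℝ → ℝ)
    (hv_deriv : ∀ t ∈ Set.Ici (0:ℝ), HasDerivWithinAt v (v' t) (Set.Ici 0) t)
    (hv'_cont : ContinuousOn v' (Set.Ici 0))
    (Bv : ℝ) (hv_bdd : ∀ t ∈ Set.Ici (0:ℝ), |v t| ≤ Bv)
    (Bv' : ℝ) (hv'_bdd : ∀ t ∈ Set.Ici (0:ℝ), |v' t| ≤ Bv')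
    (vΦ G : ℝ → ℝ)
    (hvΦ : ∀ t, vΦ t = ∫ s in Set.Ioi (0:ℝ), v s * f s t)
    (hG : ∀ t, G t = ∫ s in Set.Ioi (0:ℝ), v' s * f s t) :
    ∀ᵐ t ∂(volume.restrict (Set.Ioi (0:ℝ))),
      ∫ s in (0:ℝ)..t, nu (t - s) * (vΦ s - v 0) = ∫ s in (0:ℝ)..t, G s := by
  have hint {g : ℝ → ℝ} {c : ℝ} (hc : c ≠ 0) (h : ∫ t in Ioi (0 : ℝ), g t = c) :
      IntegrableOn g (Ioi 0) := not_imp_comm.1 integral_undef (h ▸ hc)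
  have hv_cont : ContinuousOn v (Ici 0) := fun t ht => (hv_deriv t ht).continuousWithinAt
  have hlap {w : ℝ → ℝ} (hw : ContinuousOn w (Ici 0)) {B : ℝ} (hB : ∀ s ∈ Ici (0 : ℝ), |w s| ≤ B)
      {l : ℝ} (hl : 0 < l) :
      IntegrableOn (fun t => Real.exp (-(l * t)) * ∫ s in Ioi (0 : ℝ), w s * f s t) (Ioi 0) ∧
      ∫ t in Ioi (0 : ℝ), Real.exp (-(l * t)) * ∫ s in Ioi (0 : ℝ), w s * f s t =
        Φ l / l * ∫ s in Ioi (0 : ℝ), w s * Real.exp (-(s * Φ l)) := by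
    obtain ⟨h1, h2⟩ := laplace_integral_density hf_meas hf_nonneg hf_prob hw hB hl
    refine ⟨h1, h2.trans ?_⟩
    rw [← integral_const_mul]
    refine setIntegral_congr_fun measurableSet_Ioi fun s hs => ?_
    simp only [hf_lap s hs l hl]
    ring
  have hone {l : ℝ} (hl : 0 < l) : ∫ t in Ioi (0 : ℝ), Real.exp (-(l * t)) * 1 = 1 / l := by
    simpa [neg_mul, neg_div_neg_eq] using integral_exp_mul_Ioi (neg_lt_zero.2 hl) 0
  have hconv {l : ℝ} (hl : 0 < l) :
      (IntegrableOn (fun t => Real.exp (-(l * t)) *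
        ∫ s in (0 : ℝ)..t, nu (t - s) * (vΦ s - v 0)) (Ioi 0) ∧
      IntegrableOn (fun t => Real.exp (-(l * t)) * ∫ s in (0 : ℝ)..t, G s) (Ioi 0)) ∧
      ∫ t in Ioi (0 : ℝ), Real.exp (-(l * t)) * ∫ s in (0 : ℝ)..t, nu (t - s) * (vΦ s - v 0) =
        ∫ t in Ioi (0 : ℝ), Real.exp (-(l * t)) * ∫ s in (0 : ℝ)..t, G s := by
    have hp : 0 < Φ l := hΦ_pos l hl
    have hnu_int := hint (by positivity) (hnu_lap l hl)
    have hone_int := hint (by positivity) (hone hl)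
    obtain ⟨hv1, hv2⟩ := hlap hv_cont hv_bdd hl
    obtain ⟨hG1, hG2⟩ := hlap hv'_cont hv'_bdd hl
    simp_rw [← hvΦ] at hv1 hv2
    simp_rw [← hG] at hG1 hG2
    have hsub (t : ℝ) : Real.exp (-(l * t)) * (vΦ t - v 0) =
        Real.exp (-(l * t)) * vΦ t - v 0 * (Real.exp (-(l * t)) * 1) := by ring
    have hw1 : IntegrableOn (fun t => Real.exp (-(l * t)) * (vΦ t - v 0)) (Ioi 0) := by
      simp_rw [hsub]
      exact hv1.sub (hone_int.const_mul _)
    have hw2 : ∫ t in Ioi (0 : ℝ), Real.exp (-(l * t)) * (vΦ t - v 0) =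
        1 / l * ∫ s in Ioi (0 : ℝ), v' s * Real.exp (-(s * Φ l)) := by
      simp_rw [hsub]
      rw [integral_sub hv1 (hone_int.const_mul _), integral_const_mul, hone hl, hv2,
        laplace_deriv hv_deriv hv'_cont hv_bdd hv'_bdd hp]
      ring
    obtain ⟨hl1, hl2⟩ := laplace_convolution hw1 hnu_int
    obtain ⟨hr1, hr2⟩ := laplace_convolution hG1 hone_int
    simp only [one_mul] at hr1 hr2
    refine ⟨⟨hl1, hr1⟩, ?_⟩
    rw [hl2, hr2, hw2, hG2, hnu_lap l hl, hone hl]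
    ring
  have hzero := ae_eq_zero_of_laplace_eq_zero_s13
    (h := fun t => (∫ s in (0 : ℝ)..t, nu (t - s) * (vΦ s - v 0)) - ∫ s in (0 : ℝ)..t, G s)
    (fun l hl => by
      simp only [mul_sub _ (intervalIntegral _ _ _ _)]
      exact (hconv hl).1.1.sub (hconv hl).1.2)
    (fun l hl => by
      simp only [mul_sub _ (intervalIntegral _ _ _ _)]
      rw [integral_sub (hconv hl).1.1 (hconv hl).1.2, (hconv hl).2, sub_self])
  filter_upwards [hzero] with t ht using sub_eq_zero.1 ht
end

section
/- Let λ > 0, 0 < ε ≤ M, and let W : (0,∞) → (0,∞) be continuous and bounded, nondecreasing on (0,ε], nonincreasing on [M,∞). Then there exists a constant c > 0, depending only on λ, ε, M and W, such that for every bounded measurable h : (0,∞) → [0,∞) which is nondecreasing on (0,ε] and nonincreasing on [M,∞), one has ∫₀^∞ e^{−λt} W(t) h(t) dt ≥ c ∫₀^∞ e^{−λt} h(t) dt. -/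
open MeasureTheory Set Filter
open scoped Topology

theorem integral_linear_combination {α : Type*} [MeasurableSpace α] {μ : Measure α}
    {u v w z : α → ℝ} (hu : Integrable u μ) (hv : Integrable v μ) (hw : Integrable w μ)
    (hz : Integrable z μ) (a b c d : ℝ) :
    ∫ t, (a * u t - b * v t - c * w t + d * z t) ∂μ
      = a * (∫ t, u t ∂μ) - b * (∫ t, v t ∂μ) - c * (∫ t, w t ∂μ) + d * ∫ t, z t ∂μ := by
  have huv : Integrable (fun t => a * u t - b * v t) μ := (hu.const_mul a).sub (hv.const_mul b)
  have huvw : Integrable (fun t => a * u t - b * v t - c * w t) μ := huv.sub (hw.const_mul c)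
  rw [integral_add huvw (hz.const_mul d), integral_sub huv (hw.const_mul c),
    integral_sub (hu.const_mul a) (hv.const_mul b)]
  simp only [integral_const_mul]

/-- Chebyshev's integral inequality for comonotone functions with a nonnegative weight. -/
theorem setIntegral_mul_setIntegral_le_of_monovaryOn {S : Set ℝ} (hS : MeasurableSet S)
    {p f g : ℝ → ℝ} (hp0 : ∀ t ∈ S, 0 ≤ p t) (hfg : MonovaryOn f g S)
    (hp : IntegrableOn p S) (hpf : IntegrableOn (fun t => p t * f t) S)
    (hpg : IntegrableOn (fun t => p t * g t) S)
    (hpfg : IntegrableOn (fun t => p t * f t * g t) S) :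
    (∫ t in S, p t * f t) * (∫ t in S, p t * g t)
      ≤ (∫ t in S, p t) * ∫ t in S, p t * f t * g t := by
  set P := ∫ t in S, p t with hP
  set F := ∫ t in S, p t * f t with hF
  set G := ∫ t in S, p t * g t with hG
  set Q := ∫ t in S, p t * f t * g t with hQ
  have inner_nonneg : ∀ s ∈ S, 0 ≤ f s * g s * P - f s * G - g s * F + Q := by
    intro s hs
    have e := integral_linear_combination hp hpg hpf hpfg (f s * g s) (f s) (g s) 1
    rw [one_mul, ← hP, ← hF, ← hG, ← hQ] at e
    rw [← e]
    refine setIntegral_nonneg hS fun t ht => ?_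
    have key := mul_nonneg (hp0 t ht) (monovaryOn_iff_forall_mul_nonneg.1 hfg hs ht)
    linarith
  have e := integral_linear_combination hpfg hpf hpg hp P G F Q
  rw [← hP, ← hF, ← hG, ← hQ] at e
  have outer : 0 ≤ ∫ s in S,
      (P * (p s * f s * g s) - G * (p s * f s) - F * (p s * g s) + Q * p s) := by
    refine setIntegral_nonneg hS fun s hs => ?_
    have key := mul_nonneg (hp0 s hs) (inner_nonneg s hs)
    linarith
  linarith

theorem setIntegral_pos_of_forall_pos {S : Set ℝ} (hS : MeasurableSet S) (hS0 : volume S ≠ 0)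
    {f : ℝ → ℝ} (hf0 : ∀ t ∈ S, 0 < f t) (hf : IntegrableOn f S) : 0 < ∫ t in S, f t := by
  rw [setIntegral_pos_iff_support_of_nonneg_ae
    (ae_restrict_of_forall_mem hS fun t ht => (hf0 t ht).le) hf]
  have hsub : S ⊆ Function.support f := fun t ht => (hf0 t ht).ne'
  rw [inter_eq_right.2 hsub]
  exact pos_iff_ne_zero.2 hS0

/-- Comonotone Chebyshev lower bound: the weighted Laplace transform `∫₀^∞ e^{−λt} W(t) h(t) dt`
dominates a constant multiple (independent of `h`) of the ordinary Laplace transform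
`∫₀^∞ e^{−λt} h(t) dt`, uniformly over nonnegative bounded measurable `h` that are
nondecreasing on `(0,ε]` and nonincreasing on `[M,∞)`. -/
theorem stmt_14 (l ε M : ℝ) (hl : 0 < l) (hε : 0 < ε) (hεM : ε ≤ M)
    (W : ℝ → ℝ) (hW_cont : ContinuousOn W (Set.Ioi 0))
    (hW_pos : ∀ t ∈ Set.Ioi (0:ℝ), 0 < W t)
    (BW : ℝ) (hW_bdd : ∀ t ∈ Set.Ioi (0:ℝ), W t ≤ BW)
    (hW_mono : MonotoneOn W (Set.Ioc 0 ε)) (hW_anti : AntitoneOn W (Set.Ici M)) :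
    ∃ c > (0:ℝ), ∀ h : ℝ → ℝ, Measurable h → (∀ t ∈ Set.Ioi (0:ℝ), 0 ≤ h t) →
      (∃ Bh, ∀ t ∈ Set.Ioi (0:ℝ), h t ≤ Bh) →
      MonotoneOn h (Set.Ioc 0 ε) → AntitoneOn h (Set.Ici M) →
      c * ∫ t in Set.Ioi (0:ℝ), Real.exp (-(l*t)) * h t
        ≤ ∫ t in Set.Ioi (0:ℝ), Real.exp (-(l*t)) * W t * h t := by
  have hM : 0 < M := hε.trans_le hεM
  have hp : IntegrableOn (fun t => Real.exp (-(l*t))) (Ioi 0) := by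
    simpa only [neg_mul] using integrableOn_exp_mul_Ioi (neg_neg_of_pos hl) 0
  have hpW : IntegrableOn (fun t => Real.exp (-(l*t)) * W t) (Ioi 0) := by
    refine Integrable.mul_bdd (c := BW) hp (hW_cont.aestronglyMeasurable measurableSet_Ioi) ?_
    refine ae_restrict_of_forall_mem measurableSet_Ioi fun t ht => ?_
    rw [Real.norm_of_nonneg (hW_pos t ht).le]
    exact hW_bdd t ht
  have sA : Ioc 0 ε ⊆ Ioi 0 := fun t ht => ht.1
  have sB : Ioc ε M ⊆ Ioi 0 := fun t ht => hε.trans ht.1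
  have sC : Ioi M ⊆ Ioi 0 := fun t ht => hM.trans ht
  have vA : volume (Ioc 0 ε) ≠ 0 := by simp [hε]
  have vC : volume (Ioi M) ≠ 0 := by simp
  have posp : ∀ S ⊆ Ioi (0:ℝ), MeasurableSet S → volume S ≠ 0 →
      0 < ∫ t in S, Real.exp (-(l*t)) := fun S hS mS vS =>
    setIntegral_pos_of_forall_pos mS vS (fun t _ => Real.exp_pos _) (hp.mono_set hS)
  have pospW : ∀ S ⊆ Ioi (0:ℝ), MeasurableSet S → volume S ≠ 0 →
      0 < ∫ t in S, Real.exp (-(l*t)) * W t := fun S hS mS vS =>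
    setIntegral_pos_of_forall_pos mS vS
      (fun t ht => mul_pos (Real.exp_pos _) (hW_pos t (hS ht))) (hpW.mono_set hS)
  obtain ⟨x, hx, hxmin⟩ := isCompact_Icc.exists_isMinOn (nonempty_Icc.2 hεM)
    (hW_cont.mono fun t (ht : t ∈ Icc ε M) => hε.trans_le ht.1)
  set a := (∫ t in Ioc 0 ε, Real.exp (-(l*t)) * W t) / ∫ t in Ioc 0 ε, Real.exp (-(l*t)) with ha
  set b := (∫ t in Ioi M, Real.exp (-(l*t)) * W t) / ∫ t in Ioi M, Real.exp (-(l*t)) with hb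
  have ha0 : 0 < a := div_pos (pospW _ sA measurableSet_Ioc vA) (posp _ sA measurableSet_Ioc vA)
  have hb0 : 0 < b := div_pos (pospW _ sC measurableSet_Ioi vC) (posp _ sC measurableSet_Ioi vC)
  refine ⟨min a (min (W x) b),
    lt_min ha0 (lt_min (hW_pos x (hε.trans_le hx.1)) hb0), ?_⟩
  rintro h hm h0 ⟨Bh, hB⟩ hmono hanti
  have hbd : ∀ᵐ t ∂volume.restrict (Ioi (0:ℝ)), ‖h t‖ ≤ Bh := by
    refine ae_restrict_of_forall_mem measurableSet_Ioi fun t ht => ?_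
    rw [Real.norm_of_nonneg (h0 t ht)]
    exact hB t ht
  have hph : IntegrableOn (fun t => Real.exp (-(l*t)) * h t) (Ioi 0) :=
    Integrable.mul_bdd hp hm.aestronglyMeasurable hbd
  have hpWh : IntegrableOn (fun t => Real.exp (-(l*t)) * W t * h t) (Ioi 0) :=
    Integrable.mul_bdd hpW hm.aestronglyMeasurable hbd
  have cheb : ∀ S ⊆ Ioi (0:ℝ), MeasurableSet S → volume S ≠ 0 → MonovaryOn W h S →
      (∫ t in S, Real.exp (-(l*t)) * W t) / (∫ t in S, Real.exp (-(l*t)))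
        * (∫ t in S, Real.exp (-(l*t)) * h t)
        ≤ ∫ t in S, Real.exp (-(l*t)) * W t * h t := by
    intro S hS mS vS hmv
    rw [div_mul_eq_mul_div, div_le_iff₀' (posp S hS mS vS)]
    exact setIntegral_mul_setIntegral_le_of_monovaryOn mS (fun t _ => (Real.exp_pos _).le) hmv
      (hp.mono_set hS) (hpW.mono_set hS) (hph.mono_set hS) (hpWh.mono_set hS)
  have iA := cheb _ sA measurableSet_Ioc vA (hW_mono.monovaryOn hmono)
  have iC := cheb _ sC measurableSet_Ioi vC
    ((hW_anti.mono Ioi_subset_Ici_self).monovaryOn (hanti.mono Ioi_subset_Ici_self))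
  have iB : W x * ∫ t in Ioc ε M, Real.exp (-(l*t)) * h t
      ≤ ∫ t in Ioc ε M, Real.exp (-(l*t)) * W t * h t := by
    rw [← integral_const_mul]
    refine setIntegral_mono_on ((hph.mono_set sB).const_mul _) (hpWh.mono_set sB)
      measurableSet_Ioc fun t ht => ?_
    have hWt : W x ≤ W t := hxmin (Ioc_subset_Icc_self ht)
    have := mul_le_mul_of_nonneg_right hWt
      (mul_nonneg (Real.exp_pos (-(l*t))).le (h0 t (sB ht)))
    linarith
  have split : ∀ f : ℝ → ℝ, IntegrableOn f (Ioi 0) → ∫ t in Ioi (0:ℝ), f t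
      = (∫ t in Ioc 0 ε, f t) + ((∫ t in Ioc ε M, f t) + ∫ t in Ioi M, f t) := by
    intro f hf
    rw [← setIntegral_union (Ioc_disjoint_Ioi le_rfl) measurableSet_Ioi
        (hf.mono_set sB) (hf.mono_set sC), Ioc_union_Ioi_eq_Ioi hεM,
      ← setIntegral_union (Ioc_disjoint_Ioi le_rfl) measurableSet_Ioi
        (hf.mono_set sA) (hf.mono_set (Ioi_subset_Ioi hε.le)), Ioc_union_Ioi_eq_Ioi hε.le]
  have nonneg : ∀ S ⊆ Ioi (0:ℝ), MeasurableSet S → 0 ≤ ∫ t in S, Real.exp (-(l*t)) * h t :=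
    fun S hS mS => setIntegral_nonneg mS fun t ht => mul_nonneg (Real.exp_pos _).le (h0 t (hS ht))
  rw [split _ hph, split _ hpWh, mul_add, mul_add]
  refine add_le_add (le_trans ?_ iA) (add_le_add (le_trans ?_ iB) (le_trans ?_ iC))
  · exact mul_le_mul_of_nonneg_right (min_le_left _ _) (nonneg _ sA measurableSet_Ioc)
  · exact mul_le_mul_of_nonneg_right ((min_le_right _ _).trans (min_le_left _ _))
      (nonneg _ sB measurableSet_Ioc)
  · exact mul_le_mul_of_nonneg_right ((min_le_right _ _).trans (min_le_right _ _))
      (nonneg _ sC measurableSet_Ioi)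
end

section
/- Let a < b, let 0 < ε ≤ M, and let W : (0,∞) → (0,∞) be continuous and bounded, nondecreasing on (0,ε], nonincreasing on [M,∞). Let h : [a,b] × (0,∞) → [0,∞) be bounded and measurable, with h(x,·) continuous for each x, and such that for every x ∈ [a,b], h(x,·) is nondecreasing on (0,ε] and nonincreasing on [M,∞). For λ > 0 set Y(x,λ) = ∫₀^∞ e^{−λt} W(t) h(x,t) dt and h̄(x,λ) = ∫₀^∞ e^{−λt} h(x,t) dt. Assume that for every λ > 0 the function x ↦ Y(x,λ) is twice continuously differentiable on [a,b] with ∂²_{xx} Y(x,λ) = 2λ h̄(x,λ) for all x ∈ [a,b], and Y(a,λ) = 0 and ∂_x Y(a,λ) = 0. Then h(x,t) = 0 for every x ∈ [a,b] and every t > 0. -/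
open MeasureTheory Set Filter
open scoped Topology

theorem setIntegral_le_mul_setIntegral_of_shift {f : ℝ → ℝ} {S T : Set ℝ} {C d : ℝ}
    (hS : MeasurableSet S) (hST : (fun t => t + d) ⁻¹' T = S)
    (hfS : IntegrableOn f S) (hfT : IntegrableOn f T)
    (hle : ∀ t ∈ S, f t ≤ C * f (t + d)) :
    ∫ t in S, f t ≤ C * ∫ t in T, f t := by
  have hmp := measurePreserving_add_right (volume : Measure ℝ) d
  have hemb := measurableEmbedding_addRight d
  have hint : IntegrableOn (fun t => f (t + d)) S := by
    rw [← hST]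
    exact (hmp.integrableOn_comp_preimage hemb).2 hfT
  rw [← hmp.setIntegral_preimage_emb hemb f T, hST, ← integral_const_mul]
  exact setIntegral_mono_on hfS (hint.const_mul C) hS hle

theorem integrableOn_exp_neg_mul_of_bounded {g : ℝ → ℝ} {B : ℝ}
    (hg : ContinuousOn g (Ioi 0)) (hg0 : ∀ t ∈ Ioi (0:ℝ), 0 ≤ g t)
    (hgB : ∀ t ∈ Ioi (0:ℝ), g t ≤ B) :
    IntegrableOn (fun t => Real.exp (-t) * g t) (Ioi 0) := by
  refine Integrable.mono' ((integrableOn_exp_neg_Ioi 0).mul_const B) ?_ ?_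
  · exact (ContinuousOn.mul (by fun_prop) hg).aestronglyMeasurable measurableSet_Ioi
  · filter_upwards [ae_restrict_mem measurableSet_Ioi] with t ht
    rw [Real.norm_of_nonneg (mul_nonneg (Real.exp_pos _).le (hg0 t ht))]
    exact mul_le_mul_of_nonneg_left (hgB t ht) (Real.exp_pos _).le

/-- A nonnegative function that is nondecreasing near zero and nonincreasing near infinity has
its Laplace transform at `1` controlled by its integral over a compact interval. -/
theorem integral_exp_neg_mul_le_of_monotoneOn_antitoneOn {g : ℝ → ℝ} {ε M : ℝ}
    (hε : 0 < ε) (hεM : ε ≤ M) (hg0 : ∀ t ∈ Ioi (0:ℝ), 0 ≤ g t)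
    (hint : IntegrableOn (fun t => Real.exp (-t) * g t) (Ioi 0))
    (hmono : MonotoneOn g (Ioc 0 ε)) (hanti : AntitoneOn g (Ici M)) :
    ∫ t in Ioi (0:ℝ), Real.exp (-t) * g t ≤
      (Real.exp (ε / 2) + 2) * ∫ t in Ioc (ε / 2) (M + 1), Real.exp (-t) * g t := by
  set f : ℝ → ℝ := fun t => Real.exp (-t) * g t with hf
  have hf0 : ∀ t ∈ Ioi (0:ℝ), 0 ≤ f t := fun t ht => mul_nonneg (Real.exp_pos _).le (hg0 t ht)
  have hsub {S : Set ℝ} (hS : S ⊆ Ioi 0) : IntegrableOn f S := hint.mono_set hS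
  have hmid0 : Ioc (ε / 2) (M + 1) ⊆ Ioi 0 := fun t ht => lt_trans (by positivity) ht.1
  have hM : M ∈ Ioi (0:ℝ) := hε.trans_le hεM
  have hM1 : M + 1 ∈ Ioi (0:ℝ) := mem_Ioi.2 (add_pos hM one_pos)
  have hsplit : ∫ t in Ioi (0:ℝ), f t = (∫ t in Ioc 0 (ε / 2), f t) +
      ((∫ t in Ioc (ε / 2) (M + 1), f t) + ∫ t in Ioi (M + 1), f t) := by
    rw [← setIntegral_union (Ioc_disjoint_Ioi le_rfl) measurableSet_Ioi (hsub hmid0)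
      (hsub (Ioi_subset_Ioi hM1.le)), Ioc_union_Ioi_eq_Ioi (by linarith),
      ← setIntegral_union (Ioc_disjoint_Ioi le_rfl) measurableSet_Ioi
      (hsub Ioc_subset_Ioi_self) (hsub (Ioi_subset_Ioi (by positivity))),
      Ioc_union_Ioi_eq_Ioi (by positivity)]
  have hhead : ∫ t in Ioc 0 (ε / 2), f t ≤
      Real.exp (ε / 2) * ∫ t in Ioc (ε / 2) (M + 1), f t := by
    have hsub2 : Ioc (ε / 2) ε ⊆ Ioc (ε / 2) (M + 1) := Ioc_subset_Ioc_right (by linarith)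
    have hshift : ∫ t in Ioc 0 (ε / 2), f t ≤
        Real.exp (ε / 2) * ∫ t in Ioc (ε / 2) ε, f t := by
      refine setIntegral_le_mul_setIntegral_of_shift (d := ε / 2) measurableSet_Ioc ?_
        (hsub Ioc_subset_Ioi_self) (hsub (hsub2.trans hmid0)) fun t ht => ?_
      · rw [preimage_add_const_Ioc]
        congr 1 <;> ring
      · have h1 : g t ≤ g (t + ε / 2) :=
          hmono ⟨ht.1, by linarith [ht.2]⟩ ⟨by linarith [ht.1], by linarith [ht.2]⟩ (by linarith)
        rw [hf]
        dsimp only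
        rw [← mul_assoc, ← Real.exp_add, show ε / 2 + -(t + ε / 2) = -t by ring]
        exact mul_le_mul_of_nonneg_left h1 (Real.exp_pos _).le
    refine hshift.trans (mul_le_mul_of_nonneg_left ?_ (Real.exp_pos _).le)
    refine setIntegral_mono_set (hsub hmid0) ?_ hsub2.eventuallyLE
    filter_upwards [ae_restrict_mem measurableSet_Ioc] with t ht using hf0 t (hmid0 ht)
  have htail : ∫ t in Ioi (M + 1), f t ≤ ∫ t in Ioc (ε / 2) (M + 1), f t := by
    have hshift : ∫ t in Ioi (M + 1), f t ≤ Real.exp (-1) * ∫ t in Ioi M, f t := by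
      refine setIntegral_le_mul_setIntegral_of_shift (d := -1) measurableSet_Ioi ?_
        (hsub (Ioi_subset_Ioi hM1.le)) (hsub (Ioi_subset_Ioi hM.le)) fun t ht => ?_
      · rw [preimage_add_const_Ioi]
        congr 1
        ring
      · rw [mem_Ioi] at ht
        have h1 : g t ≤ g (t + -1) :=
          hanti (mem_Ici.2 (by linarith)) (mem_Ici.2 (by linarith)) (by linarith)
        rw [hf]
        dsimp only
        rw [← mul_assoc, ← Real.exp_add, show -1 + -(t + -1) = -t by ring]
        exact mul_le_mul_of_nonneg_left h1 (Real.exp_pos _).le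
    have hle : ∫ t in Ioi M, f t ≤ ∫ t in Ioi (ε / 2), f t := by
      refine setIntegral_mono_set (hsub (Ioi_subset_Ioi (half_pos hε).le)) ?_
        (Ioi_subset_Ioi (by linarith)).eventuallyLE
      filter_upwards [ae_restrict_mem measurableSet_Ioi] with t ht
      exact hf0 t (mem_Ioi.2 ((half_pos hε).trans ht))
    rw [← Ioc_union_Ioi_eq_Ioi (show ε / 2 ≤ M + 1 by linarith),
      setIntegral_union (Ioc_disjoint_Ioi le_rfl) measurableSet_Ioi (hsub hmid0)
      (hsub (Ioi_subset_Ioi hM1.le))] at hle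
    have hB : 0 ≤ ∫ t in Ioc (ε / 2) (M + 1), f t :=
      setIntegral_nonneg measurableSet_Ioc fun t ht => hf0 t (hmid0 ht)
    have hD : 0 ≤ ∫ t in Ioi (M + 1), f t :=
      setIntegral_nonneg measurableSet_Ioi fun t ht => hf0 t (mem_Ioi.2 (lt_trans hM1 ht))
    have h2 := hshift.trans (mul_le_mul_of_nonneg_left hle (Real.exp_pos _).le)
    nlinarith [Real.exp_neg_one_lt_half]
  rw [hsplit]
  linarith

/-- For a positive weight, the weighted Laplace transform at `1` dominates the unweighted
one, uniformly over nonnegative functions that are nondecreasing near zero and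
nonincreasing near infinity. -/
theorem exists_integral_exp_neg_mul_le_weighted {W : ℝ → ℝ} {ε M : ℝ}
    (hε : 0 < ε) (hεM : ε ≤ M) (hWc : ContinuousOn W (Ioi 0))
    (hW0 : ∀ t ∈ Ioi (0:ℝ), 0 < W t) :
    ∃ C : ℝ, 0 ≤ C ∧ ∀ g : ℝ → ℝ, (∀ t ∈ Ioi (0:ℝ), 0 ≤ g t) →
      IntegrableOn (fun t => Real.exp (-t) * g t) (Ioi 0) →
      IntegrableOn (fun t => Real.exp (-t) * (W t * g t)) (Ioi 0) →
      MonotoneOn g (Ioc 0 ε) → AntitoneOn g (Ici M) →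
      ∫ t in Ioi (0:ℝ), Real.exp (-t) * g t ≤
        C * ∫ t in Ioi (0:ℝ), Real.exp (-t) * (W t * g t) := by
  have hsub : Icc (ε / 2) (M + 1) ⊆ Ioi 0 := fun t ht => lt_of_lt_of_le (by positivity) ht.1
  obtain ⟨t₀, ht₀, hmin⟩ := isCompact_Icc.exists_isMinOn
    (nonempty_Icc.2 (show ε / 2 ≤ M + 1 by linarith)) (hWc.mono hsub)
  have hc : 0 < W t₀ := hW0 t₀ (hsub ht₀)
  refine ⟨(Real.exp (ε / 2) + 2) * (W t₀)⁻¹, by positivity, fun g hg0 hint hWint hm ha => ?_⟩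
  refine (integral_exp_neg_mul_le_of_monotoneOn_antitoneOn hε hεM hg0 hint hm ha).trans ?_
  rw [mul_assoc]
  refine mul_le_mul_of_nonneg_left ?_ (by positivity)
  rw [le_inv_mul_iff₀ hc, ← integral_const_mul]
  have hsub' : Ioc (ε / 2) (M + 1) ⊆ Ioi 0 := Ioc_subset_Icc_self.trans hsub
  calc ∫ t in Ioc (ε / 2) (M + 1), W t₀ * (Real.exp (-t) * g t)
      ≤ ∫ t in Ioc (ε / 2) (M + 1), Real.exp (-t) * (W t * g t) := by
        refine setIntegral_mono_on ((hint.mono_set hsub').const_mul _) (hWint.mono_set hsub')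
          measurableSet_Ioc fun t ht => ?_
        have h1 : W t₀ ≤ W t := hmin (Ioc_subset_Icc_self ht)
        have h2 : 0 ≤ Real.exp (-t) * g t := mul_nonneg (Real.exp_pos _).le (hg0 t (hsub' ht))
        calc W t₀ * (Real.exp (-t) * g t) ≤ W t * (Real.exp (-t) * g t) :=
              mul_le_mul_of_nonneg_right h1 h2
          _ = Real.exp (-t) * (W t * g t) := by ring
    _ ≤ ∫ t in Ioi (0:ℝ), Real.exp (-t) * (W t * g t) := by
        refine setIntegral_mono_set hWint ?_ hsub'.eventuallyLE
        filter_upwards [ae_restrict_mem measurableSet_Ioi] with t ht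
        exact mul_nonneg (Real.exp_pos _).le (mul_nonneg (hW0 t ht).le (hg0 t ht))

/-- Gronwall uniqueness for a second-order differential inequality with zero Cauchy data. -/
theorem eq_zero_of_abs_second_deriv_le {u u' u'' : ℝ → ℝ} {a b K : ℝ}
    (hu : ∀ x ∈ Icc a b, HasDerivWithinAt u (u' x) (Icc a b) x)
    (hu' : ∀ x ∈ Icc a b, HasDerivWithinAt u' (u'' x) (Icc a b) x)
    (hK : ∀ x ∈ Icc a b, |u'' x| ≤ K * |u x|) (ha : u a = 0) (ha' : u' a = 0) :
    ∀ x ∈ Icc a b, u x = 0 := by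
  have hd : ∀ x ∈ Icc a b,
      HasDerivWithinAt (fun y => (u y, u' y)) (u' x, u'' x) (Icc a b) x :=
    fun x hx => (hu x hx).prodMk (hu' x hx)
  have key := eq_zero_of_abs_deriv_le_mul_abs_self_of_eq_zero_right
    (f := fun y => (u y, u' y)) (f' := fun y => (u' y, u'' y)) (K := max 1 K) (a := a) (b := b)
    (fun x hx => (hd x hx).continuousWithinAt)
    (fun x hx => (hd x (Ico_subset_Icc_self hx)).mono_of_mem_nhdsWithin
      (mem_of_superset (Icc_mem_nhdsGE hx.2) (Icc_subset_Icc_left hx.1)))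
    (by simp [ha, ha']) (fun x hx => ?_)
  · exact fun x hx => congrArg Prod.fst (key x hx)
  · simp only [Prod.norm_def, Real.norm_eq_abs]
    have h1 := hK x (Ico_subset_Icc_self hx)
    have hm : 0 ≤ max |u x| |u' x| := (abs_nonneg _).trans (le_max_left _ _)
    refine max_le ?_ ?_
    · calc |u' x| ≤ 1 * max |u x| |u' x| := by rw [one_mul]; exact le_max_right _ _
        _ ≤ max 1 K * max |u x| |u' x| := mul_le_mul_of_nonneg_right (le_max_left _ _) hm
    · calc |u'' x| ≤ K * |u x| := h1
        _ ≤ max 1 K * |u x| := mul_le_mul_of_nonneg_right (le_max_right _ _) (abs_nonneg _)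
        _ ≤ max 1 K * max |u x| |u' x| :=
          mul_le_mul_of_nonneg_left (le_max_left _ _) (zero_le_one.trans (le_max_left _ _))

/-- Isolation theorem for mild solutions of the generalized Fokker–Planck equation: if the
weighted Laplace transform `Y(x,λ) = ∫₀^∞ e^{−λt} W(t) h(x,t) dt` of the nonnegative
function `h` solves `∂²ₓₓ Y(x,λ) = 2λ h̄(x,λ)` on `[a,b]` with zero Cauchy data at `x = a`,
then `h ≡ 0`. -/
theorem stmt_15 (a b ε M : ℝ) (hab : a < b) (hε : 0 < ε) (hεM : ε ≤ M)
    (W : ℝ → ℝ) (hW_cont : ContinuousOn W (Set.Ioi 0))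
    (hW_pos : ∀ t ∈ Set.Ioi (0:ℝ), 0 < W t)
    (BW : ℝ) (hW_bdd : ∀ t ∈ Set.Ioi (0:ℝ), W t ≤ BW)
    (hW_mono : MonotoneOn W (Set.Ioc 0 ε)) (hW_anti : AntitoneOn W (Set.Ici M))
    (h : ℝ → ℝ → ℝ) (Bh : ℝ)
    (hh_meas : ∀ x ∈ Set.Icc a b, Measurable (h x))
    (hh_nonneg : ∀ x ∈ Set.Icc a b, ∀ t ∈ Set.Ioi (0:ℝ), 0 ≤ h x t)
    (hh_bdd : ∀ x ∈ Set.Icc a b, ∀ t ∈ Set.Ioi (0:ℝ), h x t ≤ Bh)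
    (hh_cont : ∀ x ∈ Set.Icc a b, ContinuousOn (h x) (Set.Ioi 0))
    (hh_mono : ∀ x ∈ Set.Icc a b, MonotoneOn (h x) (Set.Ioc 0 ε))
    (hh_anti : ∀ x ∈ Set.Icc a b, AntitoneOn (h x) (Set.Ici M))
    (Y Y' hbar : ℝ → ℝ → ℝ)
    (hY : ∀ x l, Y x l = ∫ t in Set.Ioi (0:ℝ), Real.exp (-(l*t)) * W t * h x t)
    (hhbar : ∀ x l, hbar x l = ∫ t in Set.Ioi (0:ℝ), Real.exp (-(l*t)) * h x t)
    (hY_deriv : ∀ l ∈ Set.Ioi (0:ℝ), ∀ x ∈ Set.Icc a b,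
      HasDerivWithinAt (fun y => Y y l) (Y' x l) (Set.Icc a b) x)
    (hY'_deriv : ∀ l ∈ Set.Ioi (0:ℝ), ∀ x ∈ Set.Icc a b,
      HasDerivWithinAt (fun y => Y' y l) (2*l*hbar x l) (Set.Icc a b) x)
    (hY'_cont : ∀ l ∈ Set.Ioi (0:ℝ), ContinuousOn (fun x => Y' x l) (Set.Icc a b))
    (hY''_cont : ∀ l ∈ Set.Ioi (0:ℝ), ContinuousOn (fun x => 2*l*hbar x l) (Set.Icc a b))
    (hYa : ∀ l ∈ Set.Ioi (0:ℝ), Y a l = 0) (hY'a : ∀ l ∈ Set.Ioi (0:ℝ), Y' a l = 0) :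
    ∀ x ∈ Set.Icc a b, ∀ t ∈ Set.Ioi (0:ℝ), h x t = 0 := by
  have hint : ∀ x ∈ Icc a b, IntegrableOn (fun t => Real.exp (-t) * h x t) (Ioi 0) :=
    fun x hx => integrableOn_exp_neg_mul_of_bounded (hh_cont x hx) (hh_nonneg x hx) (hh_bdd x hx)
  have hWint : ∀ x ∈ Icc a b,
      IntegrableOn (fun t => Real.exp (-t) * (W t * h x t)) (Ioi 0) := fun x hx =>
    integrableOn_exp_neg_mul_of_bounded (B := BW * Bh) (hW_cont.mul (hh_cont x hx))
      (fun t ht => mul_nonneg (hW_pos t ht).le (hh_nonneg x hx t ht))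
      (fun t ht => mul_le_mul (hW_bdd t ht) (hh_bdd x hx t ht) (hh_nonneg x hx t ht)
        ((hW_pos t ht).le.trans (hW_bdd t ht)))
  obtain ⟨C, hC, hle⟩ := exists_integral_exp_neg_mul_le_weighted hε hεM hW_cont hW_pos
  have hY1 : ∀ x, Y x 1 = ∫ t in Ioi (0:ℝ), Real.exp (-t) * (W t * h x t) := fun x => by
    simp only [hY, one_mul, mul_assoc]
  have hhbar1 : ∀ x, hbar x 1 = ∫ t in Ioi (0:ℝ), Real.exp (-t) * h x t := fun x => by
    simp only [hhbar, one_mul]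
  have hhbar0 : ∀ x ∈ Icc a b, 0 ≤ hbar x 1 := fun x hx => by
    rw [hhbar1]
    exact setIntegral_nonneg measurableSet_Ioi fun t ht =>
      mul_nonneg (Real.exp_pos _).le (hh_nonneg x hx t ht)
  have hbound : ∀ x ∈ Icc a b, hbar x 1 ≤ C * Y x 1 := fun x hx => by
    rw [hhbar1, hY1]
    exact hle (h x) (hh_nonneg x hx) (hint x hx) (hWint x hx) (hh_mono x hx) (hh_anti x hx)
  have h1 : (1:ℝ) ∈ Ioi (0:ℝ) := mem_Ioi.2 one_pos
  have hYzero : ∀ x ∈ Icc a b, Y x 1 = 0 := by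
    refine eq_zero_of_abs_second_deriv_le (K := 2 * C) (hY_deriv 1 h1) (hY'_deriv 1 h1)
      (fun x hx => ?_) (hYa 1 h1) (hY'a 1 h1)
    rw [abs_of_nonneg (mul_nonneg (by norm_num) (hhbar0 x hx))]
    have h2 := mul_le_mul_of_nonneg_left (le_abs_self (Y x 1)) hC
    linarith [hbound x hx]
  intro x hx
  have hzero : ∫ t in Ioi (0:ℝ), Real.exp (-t) * h x t = 0 := by
    have h2 := hbound x hx
    rw [hYzero x hx, mul_zero] at h2
    rw [← hhbar1]
    exact le_antisymm h2 (hhbar0 x hx)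
  rw [setIntegral_eq_zero_iff_of_nonneg_ae ?_ (hint x hx)] at hzero
  · intro t ht
    have h2 := Measure.eqOn_open_of_ae_eq hzero isOpen_Ioi
      (ContinuousOn.mul (by fun_prop) (hh_cont x hx)) continuousOn_const ht
    exact (mul_eq_zero.1 h2).resolve_left (Real.exp_pos _).ne'
  · filter_upwards [ae_restrict_mem measurableSet_Ioi] with t ht
    exact mul_nonneg (Real.exp_pos _).le (hh_nonneg x hx t ht)
end
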